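/- arXiv:1211.6287 — 3 statements merged into one kernel-verified Lean document; each statement's English description precedes it below -/
import Mathlib

section
/- Let $G_1$ and $G_2$ be graphs with no isolated vertices, of orders $n_1$ and $n_2$ respectively, and let $m$ be a positive integer such that $2^{106\sqrt{m}/\log m} \geq n - 27\sqrt{m}$, where $n = \max\{n_1, n_2\}$. Let $\alpha$ satisfy $27 \leq \alpha \leq (\log^3 m)/8$, and suppose that for $i = 1, 2$ there exists $U_i \subseteq V(G_i)$ with $|U_i| \leq \alpha\sqrt{m}$ such that $\Delta(G_i - U_i) \leq 2\sqrt{m}/\alpha$. If a blue-red edge coloring of $K_N$ contains no blue copy of $G_1$ and no red copy of $G_2$, and it contains a monochromatic pair $(X, Y)$ with $|X| \geq \alpha\sqrt{m}$ and $|Y| \geq 2^{125\alpha^{-1/3}\sqrt{m}}$, then it also contains a monochromatic pair $(X', Y')$ with $|X'| \geq 2^{2\alpha^{1/3}}\sqrt{m}$ and $|Y'| \geq 2^{-120\alpha^{-1/3}\sqrt{m}} |Y|$. -/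
/-- `G` occurs as a (not necessarily induced) subgraph copy of `H`. -/
def IsCopyIn {α β : Type*} (G : SimpleGraph α) (H : SimpleGraph β) : Prop :=
  ∃ f : α ↪ β, ∀ ⦃a b : α⦄, G.Adj a b → H.Adj (f a) (f b)

/-- `N` has the Ramsey property for the pair `(G₁, G₂)`: every blue-red edge
coloring of `K_N` (encoded by its graph of blue edges) contains a blue copy of `G₁`
or a red copy of `G₂`. -/
def RamseyProp {α β : Type*} (G₁ : SimpleGraph α) (G₂ : SimpleGraph β) (N : ℕ) : Prop :=
  ∀ blue : SimpleGraph (Fin N), IsCopyIn G₁ blue ∨ IsCopyIn G₂ blueᶜ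

/-- The Ramsey number `R(G₁, G₂)`: the smallest positive integer `N` with the
Ramsey property. -/
noncomputable def ramsey {α β : Type*} (G₁ : SimpleGraph α) (G₂ : SimpleGraph β) : ℕ :=
  sInf {N : ℕ | 0 < N ∧ RamseyProp G₁ G₂ N}

/-- `(X, Y)` is a blue monochromatic pair: `X` and `Y` are disjoint and every edge
inside `X ∪ Y` incident to a vertex of `X` is blue. -/
def IsBluePair {N : ℕ} (blue : SimpleGraph (Fin N)) (X Y : Finset (Fin N)) : Prop :=
  Disjoint X Y ∧ ∀ x ∈ X, ∀ y ∈ X ∪ Y, x ≠ y → blue.Adj x y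

/-- `(X, Y)` is a red monochromatic pair: `X` and `Y` are disjoint and every edge
inside `X ∪ Y` incident to a vertex of `X` is red. -/
def IsRedPair {N : ℕ} (blue : SimpleGraph (Fin N)) (X Y : Finset (Fin N)) : Prop :=
  Disjoint X Y ∧ ∀ x ∈ X, ∀ y ∈ X ∪ Y, x ≠ y → ¬ blue.Adj x y

/-- `(X, Y)` is a monochromatic pair. -/
def IsMonoPair {N : ℕ} (blue : SimpleGraph (Fin N)) (X Y : Finset (Fin N)) : Prop :=
  IsBluePair blue X Y ∨ IsRedPair blue X Y

open Finset in
/-- Number of neighbours of `v` in `B`. -/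
noncomputable def ndeg {V : Type*} (F : SimpleGraph V) (v : V) (B : Finset V) : ℕ := by
  classical exact (B.filter (fun b => F.Adj v b)).card

theorem ndeg_mono {V : Type*} (F : SimpleGraph V) (v : V) {A B : Finset V} (h : A ⊆ B) :
    ndeg F v A ≤ ndeg F v B := by
  classical
  unfold ndeg
  exact Finset.card_le_card (Finset.filter_subset_filter _ h)

theorem ndeg_le {V : Type*} (F : SimpleGraph V) (v : V) (B : Finset V) :
    ndeg F v B ≤ B.card := by
  classical
  unfold ndeg
  exact Finset.card_le_card (Finset.filter_subset _ _)

theorem ndeg_union {V : Type*} [DecidableEq V] (F : SimpleGraph V) (v : V) {A B : Finset V}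
    (h : Disjoint A B) : ndeg F v (A ∪ B) = ndeg F v A + ndeg F v B := by
  classical
  unfold ndeg
  rw [Finset.filter_union, Finset.card_union_of_disjoint]
  exact Finset.disjoint_filter_filter h

/-- double counting -/
theorem ndeg_comm {V : Type*} (F : SimpleGraph V) (A B : Finset V) :
    ∑ a ∈ A, ndeg F a B = ∑ b ∈ B, ndeg F b A := by
  classical
  unfold ndeg
  simp only [Finset.card_filter]
  rw [Finset.sum_comm]
  simp only [F.adj_comm]

/-- Embedding lemma: either `H` embeds in `F[Y]` or there is a sparse pair. -/
theorem embed_or_sparse {V W : Type*} [Fintype W] (F : SimpleGraph V) (H : SimpleGraph W)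
    (d P s : ℕ) (hd : 1 ≤ d) (hP : 1 ≤ P)
    (hdeg : ∀ w, ndeg H w Finset.univ ≤ d)
    (Y : Finset V) (h1 : 4 * d * P ^ d * s ≤ Y.card)
    (h2 : 2 * Fintype.card W * P ^ d ≤ Y.card)
    (hno : ¬ ∃ f : W → V, Function.Injective f ∧ (∀ w, f w ∈ Y) ∧
      ∀ u w, H.Adj u w → F.Adj (f u) (f w)) :
    ∃ A B : Finset V, A ⊆ Y ∧ B ⊆ Y ∧ Disjoint A B ∧ A.card = s ∧ 2 * s ≤ B.card ∧
      ∀ a ∈ A, P * ndeg F a B ≤ 2 * B.card := by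
  classical
  by_contra hcon
  push Not at hcon
  apply hno
  have key : ∀ D : Finset W, ∃ f : W → V, Set.InjOn f D ∧ (∀ w ∈ D, f w ∈ Y) ∧
      (∀ u ∈ D, ∀ w ∈ D, H.Adj u w → F.Adj (f u) (f w)) ∧
      ∀ w ∉ D, Y.card ≤
        (Y.filter (fun y => ∀ u ∈ D, H.Adj u w → F.Adj (f u) y)).card * P ^ (ndeg H w D) := by
    intro D
    induction D using Finset.induction_on with
    | empty =>
      by_cases hW : IsEmpty W
      · exact ⟨fun w => (hW.false w).elim, by simp, by simp, by simp, by intro w; exact (hW.false w).elim⟩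
      · have hW' : Nonempty W := not_isEmpty_iff.mp hW
        have hYpos : 0 < Y.card := by
          refine lt_of_lt_of_le ?_ h2
          have : 0 < Fintype.card W := Fintype.card_pos
          positivity
        obtain ⟨y, hy⟩ := Finset.card_pos.mp hYpos
        refine ⟨fun _ => y, by simp, by simp, by simp, ?_⟩
        intro w _
        simp [ndeg]
    | insert w D hwD ih =>
      obtain ⟨f, finj, fY, fadj, fC⟩ := ih
      set C : W → Finset V := fun w => Y.filter (fun y => ∀ u ∈ D, H.Adj u w → F.Adj (f u) y)
        with hC
      have hPpos : 0 < P ^ d := by positivity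
      have hCd : ∀ u ∉ D, Y.card ≤ (C u).card * P ^ d := by
        intro u hu
        refine (fC u hu).trans ?_
        gcongr
        exact (ndeg_mono H u (Finset.subset_univ D)).trans (hdeg u)
      have hC1 : ∀ u ∉ D, 4 * d * s ≤ (C u).card := by
        intro u hu
        have h3 := h1.trans (hCd u hu)
        have : (4 * d * s) * P ^ d ≤ (C u).card * P ^ d := by linarith
        exact Nat.le_of_mul_le_mul_right this hPpos
      have hC2 : ∀ u ∉ D, 2 * Fintype.card W ≤ (C u).card := by
        intro u hu
        have h3 := h2.trans (hCd u hu)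
        exact Nat.le_of_mul_le_mul_right h3 hPpos
      have hDk : D.card + 1 ≤ Fintype.card W := by
        have := Finset.card_le_univ (insert w D)
        rwa [Finset.card_insert_of_notMem hwD] at this
      by_cases hgood : ∃ v ∈ C w \ D.image f, ∀ u ∉ D, u ≠ w → H.Adj w u →
          (C u).card ≤ P * ndeg F v (C u)
      · obtain ⟨v, hv, hvg⟩ := hgood
        rw [Finset.mem_sdiff] at hv
        obtain ⟨hvC, hvim⟩ := hv
        simp only [hC, Finset.mem_filter] at hvC
        have hne : ∀ u ∈ D, u ≠ w := fun u hu h => hwD (h ▸ hu)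
        have hup : ∀ u ∈ D, Function.update f w v u = f u := fun u hu =>
          Function.update_of_ne (hne u hu) _ _
        refine ⟨Function.update f w v, ?_, ?_, ?_, ?_⟩
        · rw [Finset.coe_insert, Set.injOn_insert (by simpa using hwD)]
          constructor
          · intro x hx y hy hxy
            rw [hup x hx, hup y hy] at hxy
            exact finj hx hy hxy
          · rintro ⟨u, hu, hu2⟩
            rw [hup u hu, Function.update_self] at hu2
            exact hvim (Finset.mem_image.mpr ⟨u, hu, hu2⟩)
        · intro u hu
          rcases Finset.mem_insert.mp hu with rfl | hu
          · simpa using hvC.1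
          · rw [hup u hu]; exact fY u hu
        · intro u hu u' hu' hadj
          rcases Finset.mem_insert.mp hu with rfl | hu1 <;>
          rcases Finset.mem_insert.mp hu' with rfl | hu1'
          · exact (H.loopless.irrefl _ hadj).elim
          · rw [hup u' hu1', Function.update_self]
            exact (hvC.2 u' hu1' hadj.symm).symm
          · rw [hup u hu1, Function.update_self]
            exact hvC.2 u hu1 hadj
          · rw [hup u hu1, hup u' hu1']; exact fadj u hu1 u' hu1' hadj
        · intro u hu
          have huD : u ∉ D := fun h => hu (Finset.mem_insert_of_mem h)
          have huw : u ≠ w := fun h => hu (h ▸ Finset.mem_insert_self _ _)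
          by_cases hwu : H.Adj w u
          · have e1 : (Y.filter (fun y => ∀ u' ∈ insert w D, H.Adj u' u →
                F.Adj (Function.update f w v u') y)).card = ndeg F v (C u) := by
              unfold ndeg
              congr 1
              ext y
              simp only [hC, Finset.mem_filter, Finset.mem_insert, forall_eq_or_imp,
                Function.update_self]
              constructor
              · rintro ⟨hy, h3, h4⟩
                exact ⟨⟨hy, fun u' hu' ha => by simpa [hup u' hu'] using h4 u' hu' ha⟩, h3 hwu⟩
              · rintro ⟨⟨hy, h4⟩, h3⟩
                exact ⟨hy, fun _ => h3, fun u' hu' ha => by simpa [hup u' hu'] using h4 u' hu' ha⟩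
            have e2 : ndeg H u (insert w D) = ndeg H u D + 1 := by
              unfold ndeg
              rw [Finset.filter_insert, if_pos hwu.symm, Finset.card_insert_of_notMem]
              simp [hwD]
            rw [e1, e2]
            calc Y.card ≤ (C u).card * P ^ (ndeg H u D) := fC u huD
              _ ≤ (P * ndeg F v (C u)) * P ^ (ndeg H u D) := by
                  gcongr; exact hvg u huD huw hwu
              _ = _ := by ring
          · have e1 : Y.filter (fun y => ∀ u' ∈ insert w D, H.Adj u' u →
                F.Adj (Function.update f w v u') y) = C u := by
              ext y
              simp only [hC, Finset.mem_filter, Finset.mem_insert, forall_eq_or_imp]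
              constructor
              · rintro ⟨hy, h3, h4⟩
                exact ⟨hy, fun u' hu' ha => by simpa [hup u' hu'] using h4 u' hu' ha⟩
              · rintro ⟨hy, h4⟩
                exact ⟨hy, fun h => (hwu h).elim, fun u' hu' ha => by
                  simpa [hup u' hu'] using h4 u' hu' ha⟩
            have e2 : ndeg H u (insert w D) = ndeg H u D := by
              unfold ndeg
              rw [Finset.filter_insert, if_neg (fun h => hwu h.symm)]
            rw [e1, e2]
            exact fC u huD
      · exfalso
        push Not at hgood
        have : Nonempty W := ⟨w⟩
        choose! g hg1 hg2 hg3 hg4 using hgood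
        obtain ⟨T, hT⟩ : ∃ T, T = C w \ D.image f := ⟨_, rfl⟩
        rw [← hT] at hg1 hg2 hg3 hg4
        have hTcard : (C w).card ≤ T.card + D.card := by
          have h5 := Finset.le_card_sdiff (D.image f) (C w)
          have h6 : (D.image f).card ≤ D.card := Finset.card_image_le
          rw [← hT] at h5
          omega
        have hw1 := hC1 w hwD
        have hw2 := hC2 w hwD
        have hT2 : 2 * d * s ≤ T.card := by
          have : 4 * d * s = 2 * (2 * d * s) := by ring
          omega
        have hTpos : T.Nonempty := by
          apply Finset.card_pos.mp; omega
        have hmaps : ∀ v ∈ T, g v ∈ Finset.univ.filter (fun b => H.Adj w b) := by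
          intro v hv
          simpa using hg3 v hv
        have hNd : (Finset.univ.filter (fun b => H.Adj w b)).card ≤ d := by
          have := hdeg w
          unfold ndeg at this
          convert this
        obtain ⟨u, hu, hfib⟩ := Finset.exists_le_card_fiber_of_mul_le_card_of_maps_to
          (n := s) hmaps (by
            obtain ⟨v, hv⟩ := hTpos
            exact ⟨g v, hmaps v hv⟩) (by
            calc _ ≤ d * s := by gcongr
              _ ≤ 2 * d * s := by nlinarith
              _ ≤ _ := hT2)
        by_cases hs0 : s = 0
        · subst hs0
          obtain ⟨a, ha, _⟩ := hcon ∅ ∅ (by simp) (by simp) (by simp) (by simp) (by simp)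
          simp at ha
        obtain ⟨A, hA, hAc⟩ := Finset.exists_subset_card_eq hfib
        have hAT : ∀ a ∈ A, a ∈ T ∧ g a = u := by
          intro a ha
          simpa using hA ha
        have huD : u ∉ D := by
          obtain ⟨a, ha⟩ := Finset.card_pos.mp (by omega : 0 < A.card)
          obtain ⟨h6, h7⟩ := hAT a ha
          exact h7 ▸ hg1 a h6
        have hu1 := hC1 u huD
        have hu1' : 4 * s ≤ (C u).card := by
          refine le_trans ?_ hu1
          have : 1 * s ≤ d * s := Nat.mul_le_mul_right s hd
          nlinarith
        have hB : (C u).card ≤ (C u \ A).card + s := by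
          have h5 := Finset.le_card_sdiff A (C u)
          omega
        obtain ⟨a, ha, hlt⟩ := hcon A (C u \ A)
          (by intro a ha
              have := (hAT a ha).1
              rw [hT, Finset.mem_sdiff] at this
              exact (Finset.mem_filter.mp this.1).1)
          (by intro b hb
              exact (Finset.mem_filter.mp (Finset.mem_sdiff.mp hb).1).1)
          Finset.disjoint_sdiff hAc (by omega)
        obtain ⟨h6, h7⟩ := hAT a ha
        have h8 := hg4 a h6
        rw [h7] at h8
        have h9 : P * ndeg F a (C u \ A) ≤ P * ndeg F a (C u) :=
          Nat.mul_le_mul_left _ (ndeg_mono F a Finset.sdiff_subset)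
        omega
  obtain ⟨f, finj, fY, fadj, -⟩ := key Finset.univ
  exact ⟨f, fun x y h => finj (by simp) (by simp) h, fun w => fY w (by simp),
    fun u w h => fadj u (by simp) w (by simp) h⟩

/-- Markov inequality: at least half of the elements are at most twice the average. -/
theorem half_filter {V : Type*} (B : Finset V) (f : V → ℕ) (c : ℕ)
    (h : ∑ b ∈ B, f b ≤ c * B.card) :
    B.card ≤ 2 * (B.filter (fun b => f b ≤ 2 * c)).card := by
  have h1 := Finset.card_filter_add_card_filter_not (s := B) (fun b => f b ≤ 2 * c)
  have h2 : (B.filter (fun b => ¬ f b ≤ 2 * c)).card * (2 * c + 1) ≤ ∑ b ∈ B, f b := by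
    calc _ ≤ ∑ b ∈ B.filter (fun b => ¬ f b ≤ 2 * c), f b := by
          rw [← smul_eq_mul]
          apply Finset.card_nsmul_le_sum
          intro b hb
          have := (Finset.mem_filter.mp hb).2
          omega
      _ ≤ _ := Finset.sum_le_sum_of_subset (Finset.filter_subset _ _)
  by_contra hcon
  push Not at hcon
  set g := (B.filter (fun b => f b ≤ 2 * c)).card
  set k := (B.filter (fun b => ¬ f b ≤ 2 * c)).card
  nlinarith

theorem sparse_set {V W : Type*} [Fintype W] (F : SimpleGraph V) (H : SimpleGraph W)
    (d P q : ℕ) (hd : 1 ≤ d) (hP : 1 ≤ P)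
    (hdeg : ∀ w, ndeg H w Finset.univ ≤ d) (hq : Fintype.card W ≤ q) (h : ℕ) :
    ∀ Y : Finset V, (4 * d * P ^ d) ^ h * q ≤ Y.card →
    (¬ ∃ f : W → V, Function.Injective f ∧ (∀ w, f w ∈ Y) ∧
      ∀ u w, H.Adj u w → F.Adj (f u) (f w)) →
    ∃ S ⊆ Y, S.card = 2 ^ h * q ∧
      P * 2 ^ h * ∑ a ∈ S, ndeg F a S ≤ (P + 4 * 2 ^ h) * (2 ^ h * q) ^ 2 := by
  classical
  induction h with
  | zero =>
    intro Y hY _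
    obtain ⟨S, hS, hSc⟩ := Finset.exists_subset_card_eq (n := q) (by simpa using hY)
    refine ⟨S, hS, by simpa using hSc, ?_⟩
    have : ∑ a ∈ S, ndeg F a S ≤ q * q := by
      calc _ ≤ S.card • S.card := Finset.sum_le_card_nsmul _ _ _ (fun a _ => ndeg_le F a S)
        _ = _ := by rw [hSc, smul_eq_mul]
    have h2 := Nat.mul_le_mul_left P this
    simp only [pow_zero, mul_one, one_mul]
    nlinarith [Nat.zero_le (q * q)]
  | succ h ih =>
    intro Y hY hno
    set M := 4 * d * P ^ d with hM
    have hPd : 0 < P ^ d := by positivity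
    have hMq : 1 ≤ M ^ h := Nat.one_le_pow _ _ (by positivity)
    obtain ⟨A, B, hA, hB, hAB, hAc, hBc, hdegA⟩ := embed_or_sparse F H d P (M ^ h * q) hd hP hdeg Y
      (by calc _ = M ^ (h + 1) * q := by rw [← hM]; ring
            _ ≤ _ := hY)
      (by calc 2 * Fintype.card W * P ^ d ≤ 2 * q * P ^ d := by gcongr
            _ ≤ M * q := by rw [hM]; nlinarith [Nat.zero_le (q * P ^ d), Nat.mul_le_mul_right (q * P ^ d) hd]
            _ = 1 * (M * q) := by ring
            _ ≤ M ^ h * (M * q) := by gcongr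
            _ = M ^ (h + 1) * q := by ring
            _ ≤ _ := hY) hno
    have hmono : ∀ Z : Finset V, Z ⊆ Y → (¬ ∃ f : W → V, Function.Injective f ∧ (∀ w, f w ∈ Z) ∧
      ∀ u w, H.Adj u w → F.Adj (f u) (f w)) := by
      rintro Z hZ ⟨f, h1, h2, h3⟩
      exact hno ⟨f, h1, fun w => hZ (h2 w), h3⟩
    obtain ⟨A', hA', hA'c, hA'e⟩ := ih A hAc.ge (hmono A hA)
    set n := 2 ^ h * q with hn
    have hsum : ∑ b ∈ B, P * ndeg F b A' ≤ (2 * n) * B.card := by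
      rw [← Finset.mul_sum, ← ndeg_comm, Finset.mul_sum]
      calc _ ≤ A'.card • (2 * B.card) :=
            Finset.sum_le_card_nsmul _ _ _ (fun a ha => hdegA a (hA' ha))
        _ = _ := by rw [hA'c, smul_eq_mul]; ring
    have hhalf := half_filter B (fun b => P * ndeg F b A') (2 * n) hsum
    set B₁ := B.filter (fun b => P * ndeg F b A' ≤ 2 * (2 * n)) with hB₁
    have hB₁B : B₁ ⊆ B := Finset.filter_subset _ _
    obtain ⟨B', hB', hB'c, hB'e⟩ := ih B₁ (by omega) (hmono B₁ (hB₁B.trans hB))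
    have hdis : Disjoint A' B' := Finset.disjoint_of_subset_left hA'
      (Finset.disjoint_of_subset_right (hB'.trans hB₁B) hAB)
    refine ⟨A' ∪ B', Finset.union_subset (hA'.trans hA) ((hB'.trans hB₁B).trans hB), ?_, ?_⟩
    · rw [Finset.card_union_of_disjoint hdis, hA'c, hB'c, hn]; ring
    · have hcross : P * ∑ b ∈ B', ndeg F b A' ≤ 4 * n ^ 2 := by
        rw [Finset.mul_sum]
        calc _ ≤ B'.card • (2 * (2 * n)) :=
            Finset.sum_le_card_nsmul _ _ _ (fun b hb => (Finset.mem_filter.mp (hB' hb)).2)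
          _ = _ := by rw [hB'c, smul_eq_mul]; ring
      have hE : ∑ a ∈ A' ∪ B', ndeg F a (A' ∪ B') = ∑ a ∈ A', ndeg F a A' + ∑ b ∈ B', ndeg F b B'
          + 2 * ∑ b ∈ B', ndeg F b A' := by
        rw [Finset.sum_union hdis]
        simp only [ndeg_union F _ hdis, Finset.sum_add_distrib]
        rw [ndeg_comm F A' B']
        ring
      rw [hE]
      have e1 : 2 ^ (h + 1) * q = 2 * n := by rw [hn]; ring
      rw [e1]
      have hc2 := Nat.mul_le_mul_left (4 * 2 ^ h) hcross
      have e2 : (2 : ℕ) ^ (h + 1) = 2 * 2 ^ h := by ring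
      rw [e2]
      nlinarith

/-- Off-diagonal Ramsey walk. -/
theorem walk {V : Type*} [DecidableEq V] (F : SimpleGraph V) (δ : ℝ) (h0 : 0 < δ) (h1 : δ < 1) (k : ℕ) :
    ∀ (b t : ℕ), b + t = k → ∀ T : Finset V,
    (∀ J ⊆ T, (∀ x ∈ J, ∀ y ∈ J, ¬ F.Adj x y) → J.card ≤ b) →
    (t : ℝ) ≤ δ ^ b * (1 - δ) ^ t * T.card →
    ∃ X Y : Finset V, X ⊆ T ∧ Y ⊆ T ∧ Disjoint X Y ∧ (∀ x ∈ X, ∀ y ∈ X ∪ Y, x ≠ y → F.Adj x y) ∧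
      X.card = t ∧ δ ^ b * (1 - δ) ^ t * T.card - t ≤ (Y.card : ℝ) := by
  classical
  induction k with
  | zero =>
    intro b t hbt T hJ ht
    obtain ⟨rfl, rfl⟩ : b = 0 ∧ t = 0 := by omega
    exact ⟨∅, T, by simp, by simp, by simp, by simp, by simp, by simp⟩
  | succ k ih =>
    intro b t hbt T hJ ht
    rcases Nat.eq_zero_or_pos t with rfl | htpos
    · refine ⟨∅, T, by simp, by simp, by simp, by simp, by simp, ?_⟩
      have : δ ^ b ≤ 1 := pow_le_one₀ h0.le h1.le
      have : δ ^ b * (T.card : ℝ) ≤ 1 * T.card := by gcongr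
      simpa using this
    have hδb : 0 < δ ^ b := by positivity
    have h1δ : 0 < 1 - δ := by linarith
    have hTne : T.Nonempty := by
      by_contra hT
      rw [Finset.not_nonempty_iff_eq_empty] at hT
      subst hT
      have : (0 : ℝ) < t := by exact_mod_cast htpos
      simp at ht
      omega
    obtain ⟨v, hv⟩ := hTne
    have hb : 1 ≤ b := by
      simpa using hJ {v} (by simpa using hv) (by simp)
    set R := (T.erase v).filter (fun y => ¬ F.Adj v y) with hR
    set Bl := T.filter (fun y => F.Adj v y) with hBl
    have hRT : R ⊆ T := (Finset.filter_subset _ _).trans (Finset.erase_subset _ _)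
    have hBT : Bl ⊆ T := Finset.filter_subset _ _
    have hcard : Bl.card + R.card + 1 = T.card := by
      have e : Bl = (T.erase v).filter (fun y => F.Adj v y) := by
        ext y
        simp only [hBl, Finset.mem_filter, Finset.mem_erase]
        constructor
        · rintro ⟨h2, h3⟩; exact ⟨⟨h3.ne.symm, h2⟩, h3⟩
        · rintro ⟨⟨_, h2⟩, h3⟩; exact ⟨h2, h3⟩
      rw [e, hR, Finset.card_filter_add_card_filter_not, Finset.card_erase_add_one hv]
    have hcardR : (Bl.card : ℝ) + R.card + 1 = T.card := by exact_mod_cast hcard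
    by_cases hcase : δ * T.card ≤ (R.card : ℝ)
    · obtain ⟨b, rfl⟩ : ∃ b', b = b' + 1 := ⟨b - 1, by omega⟩
      have hbd : δ ^ (b + 1) * (1 - δ) ^ t * T.card ≤ δ ^ b * (1 - δ) ^ t * R.card := by
        calc _ = δ ^ b * (1 - δ) ^ t * (δ * T.card) := by ring
          _ ≤ _ := by gcongr
      obtain ⟨X, Y, hX, hY, hd, hadj, hXc, hYc⟩ := ih b t (by omega) R (by
        intro J hJR hJi
        have hvJ : v ∉ J := fun h => by
          have := hJR h
          simp [hR] at this
        have := hJ (insert v J) (Finset.insert_subset hv (hJR.trans hRT)) (by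
          intro x hx y hy
          rcases Finset.mem_insert.mp hx with rfl | hx' <;>
          rcases Finset.mem_insert.mp hy with rfl | hy'
          · exact F.loopless.irrefl _
          · exact (Finset.mem_filter.mp (hJR hy')).2
          · intro h; exact (Finset.mem_filter.mp (hJR hx')).2 h.symm
          · exact hJi x hx' y hy')
        rw [Finset.card_insert_of_notMem hvJ] at this
        omega) (ht.trans hbd)
      exact ⟨X, Y, hX.trans hRT, hY.trans hRT, hd, hadj, hXc, by linarith⟩
    · push Not at hcase
      obtain ⟨t, rfl⟩ : ∃ t', t = t' + 1 := ⟨t - 1, by omega⟩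
      have hbd : δ ^ b * (1 - δ) ^ (t + 1) * T.card - 1 ≤ δ ^ b * (1 - δ) ^ t * Bl.card := by
        have hBl' : (1 - δ) * T.card - 1 ≤ (Bl.card : ℝ) := by linarith
        have hle : δ ^ b * (1 - δ) ^ t ≤ 1 := by
          have e1 : δ ^ b ≤ 1 := pow_le_one₀ h0.le h1.le
          have e2 : (1 - δ) ^ t ≤ 1 := pow_le_one₀ h1δ.le (by linarith)
          have e3 : 0 ≤ (1 - δ) ^ t := by positivity
          nlinarith
        calc _ = δ ^ b * (1 - δ) ^ t * ((1 - δ) * T.card) - 1 := by ring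
          _ ≤ δ ^ b * (1 - δ) ^ t * ((1 - δ) * T.card) - δ ^ b * (1 - δ) ^ t := by linarith
          _ = δ ^ b * (1 - δ) ^ t * ((1 - δ) * T.card - 1) := by ring
          _ ≤ _ := by gcongr
      obtain ⟨X, Y, hX, hY, hd, hadj, hXc, hYc⟩ := ih b t (by omega) Bl
        (fun J hJB => hJ J (hJB.trans hBT)) (by push_cast at ht; linarith)
      have hvB : v ∉ Bl := by simp [hBl]
      refine ⟨insert v X, Y, Finset.insert_subset hv (hX.trans hBT), hY.trans hBT, ?_, ?_, ?_, ?_⟩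
      · rw [Finset.disjoint_insert_left]
        exact ⟨fun h => hvB (hY h), hd⟩
      · intro x hx y hy hxy
        have hsub : X ∪ Y ⊆ Bl := Finset.union_subset hX hY
        rw [Finset.insert_union] at hy
        rcases Finset.mem_insert.mp hx with rfl | hx' <;>
        rcases Finset.mem_insert.mp hy with rfl | hy'
        · exact (hxy rfl).elim
        · exact (Finset.mem_filter.mp (hsub hy')).2
        · exact (Finset.mem_filter.mp (hX hx')).2.symm
        · exact hadj x hx' y hy' hxy
      · rw [Finset.card_insert_of_notMem (fun h => hvB (hX h)), hXc]
      · push_cast; linarith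

/-- number of small subsets -/
theorem small_subsets {V : Type*} [DecidableEq V] (I : Finset V) (b : ℕ) (y : ℝ) (h0 : 0 < y) (h1 : y ≤ 1) :
    ((I.powerset.filter (fun s => s.card ≤ b)).card : ℝ) * y ^ b ≤ (1 + y) ^ I.card := by
  have e : ∑ s ∈ I.powerset, y ^ s.card = (1 + y) ^ I.card := by
    have := Finset.sum_pow_mul_eq_add_pow y (1 : ℝ) I
    simp only [one_pow, mul_one] at this
    rw [this, add_comm]
  rw [← e, ← nsmul_eq_mul]
  calc _ ≤ ∑ s ∈ I.powerset.filter (fun s => s.card ≤ b), y ^ s.card := by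
        apply Finset.card_nsmul_le_sum
        intro s hs
        exact pow_le_pow_of_le_one h0.le h1 (Finset.mem_filter.mp hs).2
    _ ≤ _ := Finset.sum_le_sum_of_subset_of_nonneg (Finset.filter_subset _ _)
        (fun _ _ _ => by positivity)

/-- A sparse set contains a large monochromatic pair. -/
theorem sparse_pair {V : Type*} [DecidableEq V] (F : SimpleGraph V) (S : Finset V) (Q b t : ℕ)
    (hb : 16 * t < Q * (b + 1)) (hbt : b ≤ t)
    (hden : Q * ∑ a ∈ S, ndeg F a S ≤ S.card ^ 2) (y Z : ℝ) (h0 : 0 < y) (h1 : y < 1) (hZ0 : 0 ≤ Z)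
    (hZ : (Z + t) * (1 + y) ^ (2 * t) ≤ y ^ b * (y ^ b * (1 - y) ^ t) * ((S.card : ℝ) / 4 - 2 * t)) :
    ∃ X Y : Finset V, Disjoint X Y ∧ ((∀ x ∈ X, ∀ y ∈ X ∪ Y, x ≠ y → F.Adj x y) ∨
      (∀ x ∈ X, ∀ y ∈ X ∪ Y, x ≠ y → ¬ F.Adj x y)) ∧ t ≤ X.card ∧ Z ≤ (Y.card : ℝ) := by
  classical
  have hhalf := half_filter S (fun v => Q * ndeg F v S) S.card (by
    rw [← Finset.mul_sum]; nlinarith)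
  set V₁ := S.filter (fun v => Q * ndeg F v S ≤ 2 * S.card) with hV₁
  have hV₁S : V₁ ⊆ S := Finset.filter_subset _ _
  obtain ⟨I, hI, hmax⟩ := Finset.exists_max_image
    (V₁.powerset.filter (fun J => (∀ x ∈ J, ∀ y ∈ J, ¬ F.Adj x y) ∧ J.card ≤ 2 * t))
    Finset.card ⟨∅, by simp⟩
  simp only [Finset.mem_filter, Finset.mem_powerset] at hI hmax
  obtain ⟨hIV, hIind, hIc⟩ := hI
  have hsum : ∑ v ∈ V₁, Q * ndeg F v I ≤ (4 * I.card) * V₁.card := by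
    rw [← Finset.mul_sum, ndeg_comm, Finset.mul_sum]
    calc _ ≤ I.card • (2 * S.card) := by
          refine Finset.sum_le_card_nsmul _ _ _ (fun i hi => ?_)
          refine le_trans ?_ (Finset.mem_filter.mp (hIV hi)).2
          exact Nat.mul_le_mul_left _ (ndeg_mono F i hV₁S)
      _ ≤ I.card * (2 * (2 * V₁.card)) := by
          rw [smul_eq_mul]; gcongr
      _ = _ := by ring
  have hhalf2 := half_filter V₁ (fun v => Q * ndeg F v I) (4 * I.card) hsum
  set G := V₁.filter (fun v => Q * ndeg F v I ≤ 2 * (4 * I.card)) with hG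
  have hGV : G ⊆ V₁ := Finset.filter_subset _ _
  have hGb : ∀ v ∈ G, ndeg F v I ≤ b := by
    intro v hv
    have h2 := (Finset.mem_filter.mp hv).2
    have h3 : Q * ndeg F v I < Q * (b + 1) := by omega
    have := Nat.lt_of_mul_lt_mul_left h3
    omega
  set G' := G \ I with hG'
  have hG'c : (S.card : ℝ) / 4 - 2 * t ≤ G'.card := by
    have h2 := Finset.le_card_sdiff I G
    rw [← hG'] at h2
    have h3 : S.card ≤ 4 * G'.card + 4 * (2 * t) := by omega
    have h4 : (S.card : ℝ) ≤ 4 * G'.card + 4 * (2 * t) := by exact_mod_cast h3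
    linarith
  set K := I.powerset.filter (fun s => s.card ≤ b) with hK
  have hmaps : ∀ v ∈ G', I.filter (fun i => F.Adj v i) ∈ K := by
    intro v hv
    rw [hK, Finset.mem_filter, Finset.mem_powerset]
    refine ⟨Finset.filter_subset _ _, ?_⟩
    have := hGb v (Finset.mem_sdiff.mp hv).1
    unfold ndeg at this
    convert this
  have hKne : K.Nonempty := ⟨∅, by simp [hK]⟩
  have hKpos : (0 : ℝ) < K.card := by exact_mod_cast hKne.card_pos
  obtain ⟨B, hB, hW⟩ := Finset.exists_le_card_fiber_of_nsmul_le_card_of_maps_to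
    (b := (G'.card : ℝ) / K.card) hmaps hKne (by
      rw [nsmul_eq_mul]; field_simp; exact le_refl _)
  set W := G'.filter (fun v => I.filter (fun i => F.Adj v i) = B) with hWdef
  rw [hK, Finset.mem_filter, Finset.mem_powerset] at hB
  obtain ⟨hBI, hBb⟩ := hB
  have hWG : W ⊆ G' := Finset.filter_subset _ _
  have hWV : W ⊆ V₁ := hWG.trans (Finset.sdiff_subset.trans hGV)
  have hWI : Disjoint I W := by
    refine Finset.disjoint_of_subset_right hWG ?_
    exact Finset.disjoint_sdiff
  have hcross : ∀ w ∈ W, ∀ i ∈ I \ B, ¬ F.Adj i w := by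
    intro w hw i hi hadj
    have h2 := (Finset.mem_filter.mp hw).2
    rw [Finset.mem_sdiff] at hi
    apply hi.2
    rw [← h2, Finset.mem_filter]
    exact ⟨hi.1, hadj.symm⟩
  -- size of W
  have hsmall := small_subsets I b y h0 h1.le
  have h1y : 0 < 1 - y := by linarith
  have hWbig : Z + t ≤ y ^ b * (1 - y) ^ t * W.card := by
    have hpos : (0 : ℝ) < (1 + y) ^ (2 * t) := by positivity
    have hI2 : (1 + y) ^ I.card ≤ (1 + y) ^ (2 * t) := pow_le_pow_right₀ (by linarith) hIc
    have hWK : (G'.card : ℝ) ≤ W.card * K.card := by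
      rwa [div_le_iff₀ hKpos] at hW
    have hyb : 0 < y ^ b := by positivity
    have hκ : 0 < y ^ b * (1 - y) ^ t := by positivity
    have h5 : (Z + t) * (1 + y) ^ (2 * t) ≤ (y ^ b * (1 - y) ^ t * W.card) * (1 + y) ^ (2 * t) := by
      calc _ ≤ y ^ b * (y ^ b * (1 - y) ^ t) * ((S.card : ℝ) / 4 - 2 * t) := hZ
        _ ≤ y ^ b * (y ^ b * (1 - y) ^ t) * (W.card * K.card) := by
            gcongr; linarith
        _ = (y ^ b * (1 - y) ^ t * W.card) * (K.card * y ^ b) := by ring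
        _ ≤ (y ^ b * (1 - y) ^ t * W.card) * (1 + y) ^ (2 * t) := by
            gcongr
            exact hsmall.trans hI2
    exact le_of_mul_le_mul_right h5 hpos
  by_cases hIt : I.card = 2 * t
  · refine ⟨I \ B, W, Finset.disjoint_of_subset_left Finset.sdiff_subset hWI, Or.inr ?_, ?_, ?_⟩
    · intro x hx z hz _
      rcases Finset.mem_union.mp hz with hz | hz
      · exact hIind x (Finset.mem_sdiff.mp hx).1 z (Finset.mem_sdiff.mp hz).1
      · exact hcross z hz x hx
    · have := Finset.le_card_sdiff B I
      omega
    · have e1 : y ^ b ≤ 1 := pow_le_one₀ h0.le h1.le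
      have e2 : (1 - y) ^ t ≤ 1 := pow_le_one₀ h1y.le (by linarith)
      have e3 : y ^ b * (1 - y) ^ t ≤ 1 * 1 := by gcongr
      have e4 : y ^ b * (1 - y) ^ t * W.card ≤ 1 * 1 * W.card := by gcongr
      have e5 : (0 : ℝ) ≤ t := by positivity
      linarith
  · have hnoJ : ∀ J ⊆ W, (∀ x ∈ J, ∀ z ∈ J, ¬ F.Adj x z) → J.card ≤ b := by
      intro J hJW hJ
      by_contra hJb
      obtain ⟨J', hJ'J, hJ'c⟩ := Finset.exists_subset_card_eq (s := J) (n := B.card + 1) (by omega)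
      have hdis : Disjoint (I \ B) J' := Finset.disjoint_of_subset_left Finset.sdiff_subset
        (Finset.disjoint_of_subset_right (hJ'J.trans hJW) hWI)
      have hcard : ((I \ B) ∪ J').card = I.card + 1 := by
        rw [Finset.card_union_of_disjoint hdis, hJ'c]
        have := Finset.card_sdiff_add_card_eq_card hBI
        omega
      have := hmax ((I \ B) ∪ J') ⟨Finset.union_subset (Finset.sdiff_subset.trans hIV)
        ((hJ'J.trans hJW).trans hWV), by
          intro x hx z hz
          rcases Finset.mem_union.mp hx with hx | hx <;> rcases Finset.mem_union.mp hz with hz | hz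
          · exact hIind x (Finset.mem_sdiff.mp hx).1 z (Finset.mem_sdiff.mp hz).1
          · exact hcross z (hJW (hJ'J hz)) x hx
          · exact fun h => hcross x (hJW (hJ'J hx)) z hz h.symm
          · exact hJ x (hJ'J hx) z (hJ'J hz), by omega⟩
      omega
    obtain ⟨X, Y, _, _, hd, hadj, hXc, hYc⟩ := walk F y h0 h1 (b + t) b t rfl W hnoJ (by linarith)
    exact ⟨X, Y, hd, Or.inl hadj, hXc.ge, by linarith⟩

/-- Combining an embedding of `U` into `X` with one of the complement into `Y`. -/
theorem combine {α : Type*} [Fintype α] {N : ℕ} (G : SimpleGraph α) (U : Set α)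
    (F : SimpleGraph (Fin N)) (X Y : Finset (Fin N)) (hd : Disjoint X Y)
    (hadj : ∀ x ∈ X, ∀ y ∈ X ∪ Y, x ≠ y → F.Adj x y) (hUX : U.ncard ≤ X.card)
    (f : (Uᶜ : Set α) → Fin N) (finj : Function.Injective f) (fY : ∀ w, f w ∈ Y)
    (fadj : ∀ u w, (G.induce Uᶜ).Adj u w → F.Adj (f u) (f w)) :
    ∃ g : α ↪ Fin N, ∀ ⦃a b : α⦄, G.Adj a b → F.Adj (g a) (g b) := by
  classical
  obtain ⟨e⟩ : Nonempty (U ↪ X) := by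
    apply Function.Embedding.nonempty_of_card_le
    rw [Fintype.card_coe, ← Set.toFinset_card, ← Set.ncard_eq_toFinset_card']
    exact hUX
  let g : α → Fin N := fun v => if h : v ∈ U then (e ⟨v, h⟩ : Fin N) else f ⟨v, h⟩
  have gU : ∀ v (h : v ∈ U), g v = e ⟨v, h⟩ := fun v h => dif_pos h
  have gC : ∀ v (h : v ∉ U), g v = f ⟨v, h⟩ := fun v h => dif_neg h
  have gX : ∀ v ∈ U, g v ∈ X := fun v h => by rw [gU v h]; exact (e ⟨v, h⟩).2
  have gY : ∀ v ∉ U, g v ∈ Y := fun v h => by rw [gC v h]; exact fY _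
  have ginj : Function.Injective g := by
    intro a b hab
    by_cases ha : a ∈ U <;> by_cases hb : b ∈ U
    · rw [gU a ha, gU b hb] at hab
      have := e.injective (Subtype.ext hab)
      simpa using this
    · exact (Finset.disjoint_left.mp hd (gX a ha) (hab ▸ gY b hb)).elim
    · exact (Finset.disjoint_left.mp hd (gX b hb) (hab ▸ gY a ha)).elim
    · rw [gC a ha, gC b hb] at hab
      have := finj hab
      simpa using this
  refine ⟨⟨g, ginj⟩, ?_⟩
  intro a b hab
  have hne : g a ≠ g b := fun h => hab.ne (ginj h)
  have gXY : ∀ v, g v ∈ X ∪ Y := fun v => by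
    by_cases h : v ∈ U
    · exact Finset.mem_union_left _ (gX v h)
    · exact Finset.mem_union_right _ (gY v h)
  show F.Adj (g a) (g b)
  by_cases ha : a ∈ U
  · exact hadj _ (gX a ha) _ (gXY b) hne
  · by_cases hb : b ∈ U
    · exact (hadj _ (gX b hb) _ (gXY a) hne.symm).symm
    · rw [gC a ha, gC b hb]
      exact fadj _ _ hab

theorem num_two_rpow (c : ℝ) (hc : 0 ≤ c) :
    1 + 0.69 * c + (0.69 * c) ^ 2 / 2 ≤ (2 : ℝ) ^ c := by
  have h1 := Real.quadratic_le_exp_of_nonneg (x := 0.69 * c) (by positivity)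
  have h2 : Real.exp (0.69 * c) ≤ (2 : ℝ) ^ c := by
    rw [Real.rpow_def_of_pos (by norm_num)]
    apply Real.exp_le_exp.mpr
    have := Real.log_two_gt_d9
    nlinarith
  linarith

theorem num_exp {u v : ℝ} (hu : 0 ≤ u) (huv : 1.5 * u ≤ v) : Real.exp u ≤ (2 : ℝ) ^ v := by
  rw [Real.rpow_def_of_pos (by norm_num)]
  apply Real.exp_le_exp.mpr
  have := Real.log_two_gt_d9
  nlinarith

/-- `(256x+70) x ⋅ 1.01 ≤ 41 ⋅ 2^(2x)`. -/
theorem num_a (x : ℝ) (hx : 3 ≤ x) : (256 * x + 70) * x * 1.01 ≤ 41 * (2 : ℝ) ^ (2 * x) := by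
  have h1 := num_two_rpow (2 * (x - 3)) (by linarith)
  have e : (2 : ℝ) ^ (2 * x) = 64 * (2 : ℝ) ^ (2 * (x - 3)) := by
    rw [show (2 : ℝ) * x = 6 + 2 * (x - 3) by ring, Real.rpow_add (by norm_num)]
    norm_num
  rw [e]
  obtain ⟨z, hz, rfl⟩ : ∃ z : ℝ, 0 ≤ z ∧ x = z + 3 := ⟨x - 3, by linarith, by ring⟩
  simp only [add_sub_cancel_right] at h1 ⊢
  nlinarith [sq_nonneg z]

theorem num_b (x l : ℝ) (hx : 3 ≤ x) (hl : 2 * x ≤ l) :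
    2 * x + 1 + l / 2 ≤ 5 * ((2 : ℝ) ^ (l / 2) / x) := by
  have h1 := num_two_rpow ((l - 6) / 2) (by linarith)
  have e : (2 : ℝ) ^ (l / 2) = 8 * (2 : ℝ) ^ ((l - 6) / 2) := by
    rw [show l / 2 = 3 + (l - 6) / 2 by ring, Real.rpow_add (by norm_num)]
    norm_num
  rw [e]
  set W := (2 : ℝ) ^ ((l - 6) / 2)
  rw [← mul_div_assoc, le_div_iff₀ (by linarith)]
  obtain ⟨z, hz, rfl⟩ : ∃ z : ℝ, 0 ≤ z ∧ l = z + 6 := ⟨l - 6, by linarith, by ring⟩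
  simp only [add_sub_cancel_right] at h1
  have h2 : (2 * x + 1 + (z + 6) / 2) * x ≤ ((z + 6) + 1 + (z + 6) / 2) * ((z + 6) / 2) := by
    gcongr <;> linarith
  nlinarith [sq_nonneg z]

theorem num_c (x s t y : ℝ) (h : ℕ) (b : ℕ) (hx : 3 ≤ x) (hs : 0 < s) (hh : (h : ℝ) ≤ 4 * x + 1)
    (hh2 : 4 * x ≤ h) (hy : y = ((2 : ℝ) ^ h)⁻¹) (ht : t ≤ 1.01 * (2 ^ (2 * x) * s))
    (ht0 : 0 ≤ t) (hb : (b : ℝ) ≤ 32 * t * y) :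
    2 * (h : ℝ) * b + 6 * t * y ≤ 41 * (s / x) := by
  have hy0 : 0 < y := by rw [hy]; positivity
  have hy1 : y * 2 ^ (4 * x) ≤ 1 := by
    rw [hy, inv_mul_le_iff₀ (by positivity), mul_one, ← Real.rpow_natCast]
    exact Real.rpow_le_rpow_of_exponent_le (by norm_num) hh2
  have e : (2 : ℝ) ^ (4 * x) = 2 ^ (2 * x) * 2 ^ (2 * x) := by
    rw [← Real.rpow_add (by norm_num)]; ring_nf
  have hna := num_a x hx
  set T := (2 : ℝ) ^ (2 * x)
  have hT : 0 < T := by positivity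
  have h0 : (0 : ℝ) ≤ h := by positivity
  calc 2 * (h : ℝ) * b + 6 * t * y ≤ 2 * (h : ℝ) * (32 * t * y) + 6 * t * y := by gcongr
    _ = (64 * h + 6) * (t * y) := by ring
    _ ≤ (64 * (4 * x + 1) + 6) * (1.01 * (T * s) * y) := by gcongr
    _ = ((256 * x + 70) * x * 1.01) * (T * y) * (s / x) := by field_simp; ring
    _ ≤ (41 * T) * (T * y) * (s / x) := by gcongr
    _ = 41 * (y * (T * T)) * (s / x) := by ring
    _ ≤ 41 * 1 * (s / x) := by rw [e] at hy1; gcongr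
    _ = _ := by ring

theorem num_d (t h b : ℕ) (y c : ℝ) (hh : 1 ≤ h) (hy : y = ((2 : ℝ) ^ h)⁻¹)
    (hc : 2 * (h : ℝ) * b + 6 * t * y ≤ c) :
    (1 + y) ^ (2 * t) ≤ y ^ b * (y ^ b * (1 - y) ^ t) * 2 ^ c := by
  have hy0 : 0 < y := by rw [hy]; positivity
  have hy2 : y ≤ 1 / 2 := by
    rw [hy, one_div]
    apply inv_anti₀ (by norm_num)
    calc (2 : ℝ) = 2 ^ 1 := by norm_num
      _ ≤ 2 ^ h := pow_le_pow_right₀ (by norm_num) hh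
  have h1y : 0 < 1 - y := by linarith
  have e1 : (1 + y) ^ 2 ≤ (1 - y) * Real.exp (4 * y) := by
    have h2 := Real.add_one_le_exp (2 * y)
    have h3 := Real.add_one_le_exp y
    have h4 : Real.exp (4 * y) = Real.exp (2 * y) * (Real.exp y) ^ 2 := by
      rw [sq, ← Real.exp_add, ← Real.exp_add]; ring_nf
    rw [h4]
    have h5 : 1 ≤ (1 - y) * Real.exp (2 * y) := by nlinarith
    have h6 : (1 + y) ^ 2 ≤ (Real.exp y) ^ 2 := by gcongr; linarith
    calc (1 + y) ^ 2 ≤ 1 * (Real.exp y) ^ 2 := by linarith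
      _ ≤ ((1 - y) * Real.exp (2 * y)) * (Real.exp y) ^ 2 := by gcongr
      _ = _ := by ring
  have e2 : y ^ b * y ^ b * (2 : ℝ) ^ (2 * (h : ℝ) * b) = 1 := by
    rw [show (2 * (h : ℝ) * b) = ((h * (b + b) : ℕ) : ℝ) by push_cast; ring, Real.rpow_natCast,
      ← pow_add, hy, pow_mul, ← mul_pow, inv_mul_cancel₀ (by positivity), one_pow]
  have e3 : (Real.exp (4 * y)) ^ t ≤ (2 : ℝ) ^ (6 * t * y) := by
    rw [← Real.exp_nat_mul]
    apply num_exp (by positivity)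
    linarith
  calc (1 + y) ^ (2 * t) = ((1 + y) ^ 2) ^ t := by rw [pow_mul]
    _ ≤ ((1 - y) * Real.exp (4 * y)) ^ t := by gcongr
    _ = (1 - y) ^ t * (Real.exp (4 * y)) ^ t := by rw [mul_pow]
    _ ≤ (1 - y) ^ t * (2 : ℝ) ^ (6 * t * y) := by gcongr
    _ = (y ^ b * y ^ b * (2 : ℝ) ^ (2 * (h : ℝ) * b)) * ((1 - y) ^ t * (2 : ℝ) ^ (6 * t * y)) := by
        rw [e2, one_mul]
    _ = y ^ b * (y ^ b * (1 - y) ^ t) * 2 ^ (2 * (h : ℝ) * b + 6 * t * y) := by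
        rw [Real.rpow_add (by norm_num)]; ring
    _ ≤ _ := by
        gcongr
        norm_num

theorem num_M (d h : ℕ) (hd : 1 ≤ d) :
    (4 * d * (2 ^ (h + 2)) ^ d) ^ h ≤ 2 ^ ((h + 4) * h * d) := by
  have h1 : d ≤ 4 ^ (d - 1) := by
    have := Nat.lt_pow_self (n := d - 1) (a := 4) (by norm_num)
    omega
  have h2 : 4 * d ≤ 2 ^ (2 * d) := by
    calc 4 * d ≤ 4 * 4 ^ (d - 1) := by gcongr
      _ = 4 ^ (d - 1 + 1) := by ring
      _ = 4 ^ d := by congr 1; omega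
      _ = _ := by rw [pow_mul]; norm_num
  calc (4 * d * (2 ^ (h + 2)) ^ d) ^ h ≤ (2 ^ (2 * d) * (2 ^ (h + 2)) ^ d) ^ h := by gcongr
    _ = _ := by rw [← pow_mul, ← pow_add, ← pow_mul]; congr 1; ring

theorem num_e (x s : ℝ) (d h : ℕ) (hx : 3 ≤ x) (hs : 0 < s) (hh : (h : ℝ) ≤ 4 * x + 1)
    (hd : (d : ℝ) ≤ 2 * s / x ^ 3) : (((h + 4) * h * d : ℕ) : ℝ) ≤ 50 * (s / x) := by
  push_cast
  calc ((h : ℝ) + 4) * h * d ≤ ((4 * x + 1) + 4) * (4 * x + 1) * (2 * s / x ^ 3) := by gcongr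
    _ = (2 * (4 * x + 5) * (4 * x + 1)) * (s / x ^ 3) := by ring
    _ ≤ (50 * x ^ 2) * (s / x ^ 3) := mul_le_mul_of_nonneg_right (by nlinarith) (by positivity)
    _ = _ := by field_simp

set_option maxHeartbeats 2000000 in
theorem core_boost {α : Type*} [Fintype α] (G : SimpleGraph α) (m : ℕ) (x : ℝ) (hx : 3 ≤ x)
    (hl : 2 * x ≤ Real.logb 2 m)
    (hcard : (Fintype.card α : ℝ) ≤ 2 ^ (106 * Real.sqrt m / Real.logb 2 m) + 27 * Real.sqrt m)
    (U : Set α) (hU : (U.ncard : ℝ) ≤ x ^ 3 * Real.sqrt m)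
    (hdeg : ∀ v, (((G.induce Uᶜ).neighborSet v).ncard : ℝ) ≤ 2 * Real.sqrt m / x ^ 3)
    {N : ℕ} (F : SimpleGraph (Fin N))
    (hno : ¬ ∃ g : α ↪ Fin N, ∀ ⦃a b : α⦄, G.Adj a b → F.Adj (g a) (g b))
    (X Y : Finset (Fin N)) (hd : Disjoint X Y)
    (hadj : ∀ x ∈ X, ∀ y ∈ X ∪ Y, x ≠ y → F.Adj x y)
    (hX : x ^ 3 * Real.sqrt m ≤ (X.card : ℝ))
    (hY : (2 : ℝ) ^ (125 * (Real.sqrt m / x)) ≤ (Y.card : ℝ)) :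
    ∃ X' Y' : Finset (Fin N), Disjoint X' Y' ∧
      ((∀ x ∈ X', ∀ y ∈ X' ∪ Y', x ≠ y → F.Adj x y) ∨
        (∀ x ∈ X', ∀ y ∈ X' ∪ Y', x ≠ y → ¬ F.Adj x y)) ∧
      (2 : ℝ) ^ (2 * x) * Real.sqrt m ≤ (X'.card : ℝ) ∧
      (2 : ℝ) ^ (-(120 * (Real.sqrt m / x))) * (Y.card : ℝ) ≤ (Y'.card : ℝ) := by
  classical
  have hUX : U.ncard ≤ X.card := by exact_mod_cast hU.trans hX
  have hnoY : ¬ ∃ f : (Uᶜ : Set α) → Fin N, Function.Injective f ∧ (∀ w, f w ∈ Y) ∧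
      ∀ u w, (G.induce Uᶜ).Adj u w → F.Adj (f u) (f w) := by
    rintro ⟨f, h1, h2, h3⟩
    exact hno (combine G U F X Y hd hadj hUX f h1 h2 h3)
  -- numerical set up
  have hm : (0 : ℝ) < m := by
    rcases Nat.eq_zero_or_pos m with rfl | h
    · simp at hl; linarith
    · exact_mod_cast h
  set l := Real.logb 2 m with hl_def
  have hs : Real.sqrt m = (2 : ℝ) ^ (l / 2) := by
    rw [Real.sqrt_eq_rpow, div_eq_mul_one_div l 2, Real.rpow_mul (by norm_num), hl_def,
      Real.rpow_logb (by norm_num) (by norm_num) hm]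
  have hnb := num_b x l hx hl
  rw [← hs] at hnb
  set s := Real.sqrt m with hs_def
  have hs8 : 8 ≤ s := by
    rw [hs]
    calc (8 : ℝ) = 2 ^ (3 : ℝ) := by norm_num
      _ ≤ _ := Real.rpow_le_rpow_of_exponent_le (by norm_num) (by linarith)
  have hspos : 0 < s := by linarith
  set E := s / x with hE
  have hE1 : 1 ≤ E := by linarith
  obtain ⟨w, hw⟩ : ∃ w : ℝ, w = 2 ^ E := ⟨_, rfl⟩
  have hwpow : ∀ c : ℕ, (2 : ℝ) ^ ((c : ℝ) * E) = w ^ c := by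
    intro c
    rw [hw, mul_comm, Real.rpow_mul (by norm_num), Real.rpow_natCast]
  have hw2 : 2 ≤ w := by
    rw [hw]
    calc (2 : ℝ) = 2 ^ (1 : ℝ) := by norm_num
      _ ≤ _ := Real.rpow_le_rpow_of_exponent_le (by norm_num) hE1
  have hw0 : 0 < w := by linarith
  have hw125 : (2 : ℝ) ^ (125 * E) = w ^ 125 := by exact_mod_cast hwpow 125
  have hw5 : (2 : ℝ) ^ (5 * E) = w ^ 5 := by exact_mod_cast hwpow 5
  have hw41 : (2 : ℝ) ^ (41 * E) = w ^ 41 := by exact_mod_cast hwpow 41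
  have hw50 : (2 : ℝ) ^ (50 * E) = w ^ 50 := by exact_mod_cast hwpow 50
  have hw53 : (2 : ℝ) ^ (53 * E) = w ^ 53 := by exact_mod_cast hwpow 53
  have hw120 : (2 : ℝ) ^ (-(120 * E)) = (w ^ 120)⁻¹ := by
    rw [Real.rpow_neg (by norm_num)]; congr 1; exact_mod_cast hwpow 120
  rw [hw125] at hY
  rw [hw120]
  -- t
  have hts : (2 : ℝ) ^ (2 * x) * s = 2 ^ (2 * x + l / 2) := by
    rw [hs, ← Real.rpow_add (by norm_num)]
  have h64 : (64 : ℝ) ≤ 2 ^ (2 * x) := by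
    calc (64 : ℝ) = 2 ^ (6 : ℝ) := by norm_num
      _ ≤ _ := Real.rpow_le_rpow_of_exponent_le (by norm_num) (by linarith)
  have h512 : (512 : ℝ) ≤ 2 ^ (2 * x) * s := by nlinarith
  set t := ⌈(2 : ℝ) ^ (2 * x) * s⌉₊ with ht_def
  have ht1 : (2 : ℝ) ^ (2 * x) * s ≤ t := Nat.le_ceil _
  have ht2 : (t : ℝ) < 2 ^ (2 * x) * s + 1 := Nat.ceil_lt_add_one (by positivity)
  have h2t : 2 * ((2 : ℝ) ^ (2 * x) * s) ≤ w ^ 5 := by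
    rw [← hw5, hts]
    calc 2 * (2 : ℝ) ^ (2 * x + l / 2) = 2 ^ (2 * x + 1 + l / 2) := by
          rw [show 2 * x + 1 + l / 2 = 1 + (2 * x + l / 2) by ring,
            Real.rpow_add (by norm_num) 1, Real.rpow_one]
      _ ≤ _ := Real.rpow_le_rpow_of_exponent_le (by norm_num) hnb
  have htw : (t : ℝ) ≤ w ^ 5 := by linarith
  -- card bound
  have hcardw : (Fintype.card α : ℝ) ≤ w ^ 54 := by
    have h1 : (2 : ℝ) ^ (106 * s / l) ≤ w ^ 53 := by
      rw [← hw53]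
      apply Real.rpow_le_rpow_of_exponent_le (by norm_num)
      rw [hE, ← mul_div_assoc, div_le_div_iff₀ (by linarith) (by linarith)]
      nlinarith
    have h2 : 27 * s ≤ w ^ 53 := by
      calc 27 * s ≤ w ^ 5 := by nlinarith
        _ ≤ w ^ 53 := pow_le_pow_right₀ (by linarith) (by norm_num)
    have h3 : w ^ 54 = w * w ^ 53 := by ring
    have h4 : 0 < w ^ 53 := by positivity
    nlinarith
  have hkα : Fintype.card (Uᶜ : Set α) ≤ Fintype.card α :=
    Fintype.card_le_of_injective _ Subtype.val_injective
  have hkw : (Fintype.card (Uᶜ : Set α) : ℝ) ≤ w ^ 54 :=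
    le_trans (by exact_mod_cast hkα) hcardw
  -- degree
  set d := ⌊2 * s / x ^ 3⌋₊ with hd_def
  have hdle : (d : ℝ) ≤ 2 * s / x ^ 3 := Nat.floor_le (by positivity)
  have hdeg' : ∀ v, ndeg (G.induce Uᶜ) v Finset.univ ≤ d := by
    intro v
    apply Nat.le_floor
    refine le_trans (le_of_eq ?_) (hdeg v)
    unfold ndeg
    rw [← Set.ncard_coe_finset]
    congr 2
    ext u
    simp
  have hdpos : 1 ≤ d := by
    by_contra hd0
    have hd0' : d = 0 := by omega
    apply hnoY
    have hkY : Fintype.card (Uᶜ : Set α) ≤ Fintype.card Y := by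
      rw [Fintype.card_coe]
      have : w ^ 54 ≤ w ^ 125 := pow_le_pow_right₀ (by linarith) (by norm_num)
      exact_mod_cast hkw.trans (this.trans hY)
    obtain ⟨e⟩ := Function.Embedding.nonempty_of_card_le hkY
    refine ⟨fun u => e u, fun a b hab => e.injective (Subtype.ext hab), fun u => (e u).2, ?_⟩
    intro u u' huu
    exfalso
    have := hdeg' u
    rw [hd0'] at this
    unfold ndeg at this
    rw [Nat.le_zero, Finset.card_eq_zero] at this
    have h2 : u' ∈ Finset.univ.filter (fun b => (G.induce Uᶜ).Adj u b) := by simpa using huu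
    have h3 : u' ∈ (∅ : Finset (Uᶜ : Set α)) := by
      rw [← this]; convert h2
    simp at h3
  -- h
  set h := ⌈4 * x⌉₊ with hh_def
  have hh1 : 4 * x ≤ h := Nat.le_ceil _
  have hh2 : (h : ℝ) ≤ 4 * x + 1 := (Nat.ceil_lt_add_one (by positivity)).le
  have hh12 : 12 ≤ h := by
    have : (12 : ℝ) ≤ h := by linarith
    exact_mod_cast this
  set M := 4 * d * (2 ^ (h + 2)) ^ d with hM
  have hMpos : 0 < M ^ h := by positivity
  have hMw : ((M ^ h : ℕ) : ℝ) ≤ w ^ 50 := by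
    rw [← hw50]
    calc ((M ^ h : ℕ) : ℝ) ≤ ((2 ^ ((h + 4) * h * d) : ℕ) : ℝ) := by
          exact_mod_cast num_M d h hdpos
      _ = (2 : ℝ) ^ ((((h + 4) * h * d : ℕ)) : ℝ) := by rw [Real.rpow_natCast]; push_cast; rfl
      _ ≤ _ := Real.rpow_le_rpow_of_exponent_le (by norm_num) (num_e x s d h hx hspos hh2 hdle)
  set q := Y.card / M ^ h with hq
  obtain ⟨Z, hZ⟩ : ∃ Z : ℝ, Z = (w ^ 120)⁻¹ * (Y.card : ℝ) := ⟨_, rfl⟩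
  have hZ5 : w ^ 5 ≤ Z := by
    rw [hZ, le_inv_mul_iff₀ (by positivity)]
    calc w ^ 120 * w ^ 5 = w ^ 125 := by ring
      _ ≤ _ := hY
  have hZpos : 0 < Z := lt_of_lt_of_le (by positivity) hZ5
  have hqlow : Z * w ^ 70 ≤ q + 1 := by
    have h1 : Y.card < M ^ h * (q + 1) := Nat.lt_mul_div_succ _ hMpos
    have h2 : (Y.card : ℝ) ≤ (M ^ h : ℕ) * ((q : ℝ) + 1) := by exact_mod_cast h1.le
    have h3 : (Y.card : ℝ) ≤ w ^ 50 * ((q : ℝ) + 1) := h2.trans (by gcongr)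
    have h4 : (Y.card : ℝ) = Z * w ^ 120 := by rw [hZ]; field_simp
    have h5 : w ^ 50 * (Z * w ^ 70) ≤ w ^ 50 * ((q : ℝ) + 1) := by
      rw [h4] at h3
      calc _ = Z * w ^ 120 := by ring
        _ ≤ _ := h3
    exact le_of_mul_le_mul_left h5 (by positivity)
  have hkq : Fintype.card (Uᶜ : Set α) ≤ q := by
    have h1 : w ^ 54 + 1 ≤ Z * w ^ 70 := by
      have h2 : w ^ 5 * w ^ 70 ≤ Z * w ^ 70 := by gcongr
      have h3 : w ^ 55 ≤ w ^ 75 := pow_le_pow_right₀ (by linarith) (by norm_num)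
      have h4 : (1 : ℝ) ≤ w ^ 54 := one_le_pow₀ (by linarith)
      have h5 : w ^ 55 = w * w ^ 54 := by ring
      have h6 : w ^ 5 * w ^ 70 = w ^ 75 := by ring
      nlinarith
    have h2 : (Fintype.card (Uᶜ : Set α) : ℝ) ≤ q := by linarith
    exact_mod_cast h2
  obtain ⟨S, hSY, hSc, hSe⟩ := sparse_set F (G.induce Uᶜ) d (2 ^ (h + 2)) q hdpos
    Nat.one_le_two_pow hdeg' hkq h Y (by rw [← hM, hq]; exact Nat.mul_div_le _ _) hnoY
  have hqS : q ≤ S.card := by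
    rw [hSc]; exact Nat.le_mul_of_pos_left _ (by positivity)
  -- density
  set Q := 2 ^ (h - 1) with hQ
  have hden : Q * ∑ a ∈ S, ndeg F a S ≤ S.card ^ 2 := by
    rw [← hSc] at hSe
    have e1 : 2 ^ (h + 2) = 8 * Q := by
      rw [hQ, show h + 2 = (h - 1) + 3 by omega, pow_add]; ring
    have e2 : 2 ^ h = 2 * Q := by
      obtain ⟨h', hh'⟩ : ∃ h', h = h' + 1 := ⟨h - 1, by omega⟩
      rw [hQ, hh', pow_succ]; simp; ring
    rw [e1, e2] at hSe
    have hQ0 : 0 < 16 * Q := by positivity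
    refine Nat.le_of_mul_le_mul_left ?_ hQ0
    calc 16 * Q * (Q * ∑ a ∈ S, ndeg F a S) = 8 * Q * (2 * Q) * ∑ a ∈ S, ndeg F a S := by ring
      _ ≤ _ := hSe
      _ = _ := by ring
  have hQ16 : 16 ≤ Q := by
    calc 16 = 2 ^ 4 := by norm_num
      _ ≤ Q := Nat.pow_le_pow_right (by norm_num) (by omega)
  obtain ⟨y, hy⟩ : ∃ y : ℝ, y = ((2 : ℝ) ^ h)⁻¹ := ⟨_, rfl⟩
  have hy0 : 0 < y := by rw [hy]; positivity
  have hy1 : y < 1 := by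
    rw [hy]
    exact inv_lt_one_of_one_lt₀ (one_lt_pow₀ (by norm_num) (by omega))
  set b := 16 * t / Q with hb
  have hbt : b ≤ t := by
    calc b ≤ 16 * t / 16 := Nat.div_le_div_left hQ16 (by norm_num)
      _ = t := by omega
  have hby : (b : ℝ) ≤ 32 * t * y := by
    have h1 : (b : ℝ) ≤ ((16 * t : ℕ) : ℝ) / (Q : ℝ) := Nat.cast_div_le
    have h2 : ((2 : ℝ) ^ h) = 2 * Q := by
      obtain ⟨h', hh'⟩ : ∃ h', h = h' + 1 := ⟨h - 1, by omega⟩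
      rw [hQ, hh', pow_succ]; push_cast; ring
    have hQ0 : (0 : ℝ) < Q := by positivity
    rw [hy, h2]
    refine h1.trans (le_of_eq ?_)
    push_cast
    field_simp
    ring
  have hnc := num_c x s t y h b hx hspos hh2 hh1 hy (by linarith) (by positivity) hby
  have hnd := num_d t h b y (41 * (s / x)) (by omega) hy hnc
  rw [← hE, hw41] at hnd
  have hfinal : (Z + t) * w ^ 41 ≤ (S.card : ℝ) / 4 - 2 * t := by
    have h1 : (q : ℝ) ≤ S.card := by exact_mod_cast hqS
    have h2 : 1 ≤ w ^ 41 := one_le_pow₀ (by linarith)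
    have h3 : (32 : ℝ) ≤ w ^ 29 := by
      calc (32 : ℝ) = 2 ^ 5 := by norm_num
        _ ≤ w ^ 5 := by gcongr
        _ ≤ w ^ 29 := pow_le_pow_right₀ (by linarith) (by norm_num)
    have h4 : 32 * (Z * w ^ 41) ≤ Z * w ^ 70 := by
      calc 32 * (Z * w ^ 41) ≤ w ^ 29 * (Z * w ^ 41) := by gcongr
        _ = _ := by ring
    have h5 : (t : ℝ) ≤ Z := htw.trans hZ5
    have h6 : (t : ℝ) * w ^ 41 ≤ Z * w ^ 41 := by gcongr
    have h7 : Z * 1 ≤ Z * w ^ 41 := by gcongr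
    have h8 : 1 ≤ Z := le_trans (one_le_pow₀ (by linarith)) hZ5
    linarith
  obtain ⟨X', Y', hdis, hor, hX', hY'⟩ := sparse_pair F S Q b t
    (Nat.lt_mul_div_succ _ (by omega)) hbt hden y Z hy0 hy1 hZpos.le (by
      have hpos : 0 ≤ y ^ b * (y ^ b * (1 - y) ^ t) := by
        have : 0 < 1 - y := by linarith
        positivity
      calc (Z + t) * (1 + y) ^ (2 * t) ≤ (Z + t) * (y ^ b * (y ^ b * (1 - y) ^ t) * w ^ 41) := by
            gcongr
        _ = y ^ b * (y ^ b * (1 - y) ^ t) * ((Z + t) * w ^ 41) := by ring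
        _ ≤ _ := by gcongr)
  refine ⟨X', Y', hdis, hor, ht1.trans (by exact_mod_cast hX'), ?_⟩
  rw [← hZ]; exact hY'

/-- Lemma 2.4: boosting a monochromatic pair in a coloring with no blue `G₁`
and no red `G₂`. -/
theorem mono_pair_boost {α β : Type*} [Fintype α] [Fintype β]
    (G₁ : SimpleGraph α) (G₂ : SimpleGraph β)
    (hiso₁ : ∀ v : α, (G₁.neighborSet v).Nonempty)
    (hiso₂ : ∀ v : β, (G₂.neighborSet v).Nonempty)
    (m : ℕ) (hm : 0 < m)
    (n : ℕ) (hn : n = max (Fintype.card α) (Fintype.card β))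
    (hbig : (2 : ℝ) ^ (106 * Real.sqrt m / Real.logb 2 m) ≥ (n : ℝ) - 27 * Real.sqrt m)
    (a : ℝ) (ha27 : 27 ≤ a) (ha : a ≤ (Real.logb 2 m) ^ 3 / 8)
    (hU₁ : ∃ U₁ : Set α, (U₁.ncard : ℝ) ≤ a * Real.sqrt m ∧
      ∀ v, (((G₁.induce U₁ᶜ).neighborSet v).ncard : ℝ) ≤ 2 * Real.sqrt m / a)
    (hU₂ : ∃ U₂ : Set β, (U₂.ncard : ℝ) ≤ a * Real.sqrt m ∧
      ∀ v, (((G₂.induce U₂ᶜ).neighborSet v).ncard : ℝ) ≤ 2 * Real.sqrt m / a)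
    (N : ℕ) (blue : SimpleGraph (Fin N))
    (hblue : ¬ IsCopyIn G₁ blue) (hred : ¬ IsCopyIn G₂ blueᶜ)
    (X Y : Finset (Fin N)) (hXY : IsMonoPair blue X Y)
    (hX : a * Real.sqrt m ≤ (X.card : ℝ))
    (hY : (2 : ℝ) ^ (125 * a ^ (-(1 : ℝ) / 3) * Real.sqrt m) ≤ (Y.card : ℝ)) :
    ∃ X' Y' : Finset (Fin N), IsMonoPair blue X' Y' ∧
      (2 : ℝ) ^ (2 * a ^ ((1 : ℝ) / 3)) * Real.sqrt m ≤ (X'.card : ℝ) ∧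
      (2 : ℝ) ^ (-(120 * a ^ (-(1 : ℝ) / 3) * Real.sqrt m)) * (Y.card : ℝ) ≤ (Y'.card : ℝ) := by
  obtain ⟨x, hx_def⟩ : ∃ x : ℝ, x = a ^ ((1 : ℝ) / 3) := ⟨_, rfl⟩
  have ha0 : 0 < a := by linarith
  have hx0 : 0 < x := by rw [hx_def]; positivity
  have hx3 : x ^ 3 = a := by
    rw [hx_def, ← Real.rpow_natCast, ← Real.rpow_mul ha0.le]; norm_num
  have hxinv : a ^ (-(1 : ℝ) / 3) = x⁻¹ := by
    rw [hx_def, ← Real.rpow_neg ha0.le]; congr 1; ring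
  have hx : 3 ≤ x := by
    by_contra hlt
    push Not at hlt
    have : x ^ 3 < 3 ^ 3 := by gcongr
    norm_num at this
    linarith
  have hl : 2 * x ≤ Real.logb 2 m := by
    by_contra hlt
    push Not at hlt
    have h1 : (Real.logb 2 m) ^ 3 < (2 * x) ^ 3 := Odd.strictMono_pow (by decide) hlt
    have h2 : (2 * x) ^ 3 = 8 * a := by rw [mul_pow, hx3]; norm_num
    linarith
  have e125 : 125 * x⁻¹ * Real.sqrt m = 125 * (Real.sqrt m / x) := by rw [div_eq_mul_inv]; ring
  have e120 : 120 * x⁻¹ * Real.sqrt m = 120 * (Real.sqrt m / x) := by rw [div_eq_mul_inv]; ring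
  rw [hxinv, e125] at hY
  rw [hxinv, e120, ← hx_def]
  rw [← hx3] at hX hU₁ hU₂
  rcases hXY with ⟨hd, hadj⟩ | ⟨hd, hadj⟩
  · obtain ⟨U, hU, hdeg⟩ := hU₁
    have hc : (Fintype.card α : ℝ) ≤ n := by
      rw [hn]; exact_mod_cast le_max_left _ _
    obtain ⟨X', Y', hdis, hor, h1, h2⟩ := core_boost G₁ m x hx hl (by linarith) U hU hdeg blue hblue
      X Y hd hadj hX hY
    refine ⟨X', Y', ?_, h1, h2⟩
    rcases hor with h | h
    · exact Or.inl ⟨hdis, h⟩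
    · exact Or.inr ⟨hdis, h⟩
  · obtain ⟨U, hU, hdeg⟩ := hU₂
    have hc : (Fintype.card β : ℝ) ≤ n := by
      rw [hn]; exact_mod_cast le_max_right _ _
    obtain ⟨X', Y', hdis, hor, h1, h2⟩ := core_boost G₂ m x hx hl (by linarith) U hU hdeg blueᶜ hred
      X Y hd (fun u hu v hv huv => by
        rw [SimpleGraph.compl_adj]; exact ⟨huv, hadj u hu v hv huv⟩) hX hY
    refine ⟨X', Y', ?_, h1, h2⟩
    rcases hor with h | h
    · refine Or.inr ⟨hdis, fun u hu v hv huv => ?_⟩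
      have := h u hu v hv huv
      rw [SimpleGraph.compl_adj] at this
      exact this.2
    · refine Or.inl ⟨hdis, fun u hu v hv huv => ?_⟩
      have := h u hu v hv huv
      rw [SimpleGraph.compl_adj] at this
      by_contra hn'
      exact this ⟨huv, hn'⟩
end

section
/- Let $0 < \epsilon \leq 1/7$ and let $t$ and $N$ be positive integers satisfying $t \geq \epsilon^{-1}$ and $N \geq t\,\epsilon^{-14\epsilon t}$. Then every blue-red edge coloring of the complete graph $K_N$ in which the edge density of the graph of blue edges is at most $\epsilon$ contains a monochromatic pair $(X, Y)$ with $|X| \geq t$ and $|Y| \geq \epsilon^{14\epsilon t} N$. -/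
/-- Off-diagonal Ramsey statement for pairs. -/
theorem ramsey_pair {N : ℕ} (blue : SimpleGraph (Fin N)) (y : ℕ) (hy : 0 < y) :
    ∀ n a b : ℕ, a + b = n → ∀ W : Finset (Fin N), y * (a + b).choose a ≤ W.card →
      ∃ X Y : Finset (Fin N), X ⊆ W ∧ Y ⊆ W ∧ y ≤ Y.card ∧
        ((IsRedPair blue X Y ∧ X.card = a) ∨ (IsBluePair blue X Y ∧ X.card = b)) := by
  classical
  intro n
  induction n with
  | zero =>
    intro a b hab W hW
    obtain ⟨rfl, rfl⟩ : a = 0 ∧ b = 0 := by omega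
    exact ⟨∅, W, by simp, by simp, by simpa using hW, Or.inl ⟨by simp [IsRedPair], by simp⟩⟩
  | succ n ih =>
    intro a b hab W hW
    rcases Nat.eq_zero_or_pos a with rfl | ha
    · exact ⟨∅, W, by simp, by simp, by simpa using hW, Or.inl ⟨by simp [IsRedPair], by simp⟩⟩
    rcases Nat.eq_zero_or_pos b with rfl | hb
    · exact ⟨∅, W, by simp, by simp, by simpa using hW, Or.inr ⟨by simp [IsBluePair], by simp⟩⟩
    obtain ⟨a, rfl⟩ : ∃ a', a = a' + 1 := ⟨a - 1, by omega⟩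
    obtain ⟨b, rfl⟩ : ∃ b', b = b' + 1 := ⟨b - 1, by omega⟩
    have hch : (a + 1 + (b + 1)).choose (a + 1)
        = (a + (b + 1)).choose a + (a + 1 + b).choose (a + 1) := by
      have h1 : a + 1 + (b + 1) = (a + (b + 1)) + 1 := by omega
      have h2 : a + 1 + b = a + (b + 1) := by omega
      rw [h1, h2, Nat.choose_succ_succ]
    rw [hch, Nat.mul_add] at hW
    have hp1 : 0 < y * (a + (b + 1)).choose a :=
      Nat.mul_pos hy (Nat.choose_pos (by omega))
    have hWne : W.Nonempty := by
      rw [← Finset.card_pos]; omega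
    obtain ⟨v, hv⟩ := hWne
    have hsplit := Finset.card_filter_add_card_filter_not (s := W.erase v) (fun w => blue.Adj v w)
    rw [Finset.card_erase_of_mem hv] at hsplit
    by_cases hR : y * (a + (b + 1)).choose a ≤
        ((W.erase v).filter (fun w => ¬ blue.Adj v w)).card
    · obtain ⟨X, Y, hX, hY, hYc, h⟩ := ih a (b + 1) (by omega) _ hR
      have hXW : X ⊆ W := fun x hx => Finset.mem_of_mem_erase (Finset.mem_filter.1 (hX hx)).1
      have hYW : Y ⊆ W := fun x hx => Finset.mem_of_mem_erase (Finset.mem_filter.1 (hY hx)).1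
      rcases h with ⟨⟨hd, hr⟩, hc⟩ | h
      · have hvX : v ∉ X := fun hx => by simpa using hX hx
        have hvY : v ∉ Y := fun hx => by simpa using hY hx
        refine ⟨insert v X, Y, Finset.insert_subset hv hXW, hYW, hYc, Or.inl ⟨⟨?_, ?_⟩, ?_⟩⟩
        · rw [Finset.disjoint_insert_left]; exact ⟨hvY, hd⟩
        · have key : ∀ z ∈ X ∪ Y, ¬ blue.Adj v z := by
            intro z hz
            rcases Finset.mem_union.1 hz with hz | hz
            · exact (Finset.mem_filter.1 (hX hz)).2
            · exact (Finset.mem_filter.1 (hY hz)).2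
          intro x hx z hz hxz
          rw [Finset.insert_union] at hz
          rcases Finset.mem_insert.1 hx with rfl | hxX
          · rcases Finset.mem_insert.1 hz with rfl | hz
            · exact absurd rfl hxz
            · exact key z hz
          · rcases Finset.mem_insert.1 hz with rfl | hz
            · intro h; exact key x (Finset.mem_union_left _ hxX) h.symm
            · exact hr x hxX z hz hxz
        · rw [Finset.card_insert_of_notMem hvX, hc]
      · exact ⟨X, Y, hXW, hYW, hYc, Or.inr h⟩
    · have hB : y * (a + 1 + b).choose (a + 1) ≤
        ((W.erase v).filter (fun w => blue.Adj v w)).card := by omega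
      obtain ⟨X, Y, hX, hY, hYc, h⟩ := ih (a + 1) b (by omega) _ hB
      have hXW : X ⊆ W := fun x hx => Finset.mem_of_mem_erase (Finset.mem_filter.1 (hX hx)).1
      have hYW : Y ⊆ W := fun x hx => Finset.mem_of_mem_erase (Finset.mem_filter.1 (hY hx)).1
      rcases h with h | ⟨⟨hd, hr⟩, hc⟩
      · exact ⟨X, Y, hXW, hYW, hYc, Or.inl h⟩
      · have hvX : v ∉ X := fun hx => by simpa using hX hx
        have hvY : v ∉ Y := fun hx => by simpa using hY hx
        refine ⟨insert v X, Y, Finset.insert_subset hv hXW, hYW, hYc, Or.inr ⟨⟨?_, ?_⟩, ?_⟩⟩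
        · rw [Finset.disjoint_insert_left]; exact ⟨hvY, hd⟩
        · have key : ∀ z ∈ X ∪ Y, blue.Adj v z := by
            intro z hz
            rcases Finset.mem_union.1 hz with hz | hz
            · exact (Finset.mem_filter.1 (hX hz)).2
            · exact (Finset.mem_filter.1 (hY hz)).2
          intro x hx z hz hxz
          rw [Finset.insert_union] at hz
          rcases Finset.mem_insert.1 hx with rfl | hxX
          · rcases Finset.mem_insert.1 hz with rfl | hz
            · exact absurd rfl hxz
            · exact key z hz
          · rcases Finset.mem_insert.1 hz with rfl | hz
            · exact (key x (Finset.mem_union_left _ hxX)).symm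
            · exact hr x hxX z hz hxz
        · rw [Finset.card_insert_of_notMem hvX, hc]

/-- Number of small subsets. -/
theorem small_subsets_bound {α : Type*} [DecidableEq α] (I : Finset α) (l x : ℝ) (hl0 : 0 < l)
    (hl1 : l ≤ 1) :
    (((I.powerset.filter (fun S => (S.card : ℝ) ≤ x)).card : ℝ)) * l ^ x ≤ (1 + l) ^ I.card := by
  have h1 : ∑ S ∈ I.powerset, l ^ S.card = (1 + l) ^ I.card := by
    have := Finset.sum_pow_mul_eq_add_pow l 1 I
    simp only [one_pow, mul_one] at this
    rw [this, add_comm]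
  rw [← h1, ← nsmul_eq_mul, ← Finset.sum_const]
  calc ∑ S ∈ I.powerset.filter (fun S => (S.card : ℝ) ≤ x), l ^ x
      ≤ ∑ S ∈ I.powerset.filter (fun S => (S.card : ℝ) ≤ x), l ^ S.card := by
        apply Finset.sum_le_sum
        intro S hS
        rw [← Real.rpow_natCast]
        exact Real.rpow_le_rpow_of_exponent_ge hl0 hl1 (Finset.mem_filter.1 hS).2
    _ ≤ _ := Finset.sum_le_sum_of_subset_of_nonneg (Finset.filter_subset _ _)
        (fun _ _ _ => by positivity)

theorem choose_bound (n a : ℕ) (l x : ℝ) (hl0 : 0 < l) (hl1 : l ≤ 1) (ha : (a : ℝ) ≤ x) :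
    (n.choose a : ℝ) * l ^ x ≤ (1 + l) ^ n := by
  by_cases han : a ≤ n
  · have h1 : (1 + l) ^ n = ∑ m ∈ Finset.range (n + 1), l ^ m * (n.choose m : ℝ) := by
      rw [add_comm, add_pow]; simp
    rw [h1]
    have h2 : l ^ x ≤ l ^ a := by
      rw [← Real.rpow_natCast]
      exact Real.rpow_le_rpow_of_exponent_ge hl0 hl1 ha
    calc (n.choose a : ℝ) * l ^ x ≤ l ^ a * (n.choose a : ℝ) := by
          rw [mul_comm]; gcongr
      _ ≤ _ := Finset.single_le_sum (f := fun m => l ^ m * (n.choose m : ℝ))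
          (fun _ _ => by positivity) (Finset.mem_range.2 (by omega))
  · rw [Nat.choose_eq_zero_of_lt (by omega)]
    simp; positivity

/-- The numerical inequality. -/
theorem numeric_bound (ε : ℝ) (hε0 : 0 < ε) (hε : ε ≤ 1 / 7) (u P C A : ℝ) (hu : 1 ≤ u)
    (hP0 : 0 ≤ P) (hC0 : 0 ≤ C) (hA0 : 0 ≤ A)
    (hA : A ≤ Real.exp (6 * u))
    (hP : P * (6 * ε) ^ (6 * u) ≤ A) (hC : C * (6 * ε) ^ (7 * u) ≤ A ^ 2) :
    14 * (P * C) * ε ^ (14 * u) ≤ 1 := by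
  have h6 : (0 : ℝ) < 6 * ε := by positivity
  have hPC : P * C * (6 * ε) ^ (13 * u) ≤ Real.exp (18 * u) := by
    have e : (6 * ε) ^ (13 * u) = (6 * ε) ^ (6 * u) * (6 * ε) ^ (7 * u) := by
      rw [← Real.rpow_add h6]; congr 1; ring
    have e2 : Real.exp (18 * u) = Real.exp (6 * u) ^ 3 := by
      rw [← Real.exp_nat_mul]; congr 1; push_cast; ring
    rw [e, e2]
    calc P * C * ((6 * ε) ^ (6 * u) * (6 * ε) ^ (7 * u))
        = (P * (6 * ε) ^ (6 * u)) * (C * (6 * ε) ^ (7 * u)) := by ring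
      _ ≤ A * A ^ 2 := mul_le_mul hP hC (by positivity) hA0
      _ = A ^ 3 := by ring
      _ ≤ _ := by gcongr
  have hmul : (6 * ε) ^ (13 * u) = ((6 : ℝ) ^ 13) ^ u * ε ^ (13 * u) := by
    rw [Real.mul_rpow (by norm_num) hε0.le, Real.rpow_mul (by norm_num : (0:ℝ) ≤ 6)]
    norm_num
  have hexp : Real.exp (18 * u) ≤ ((3 : ℝ) ^ 18) ^ u := by
    have : Real.exp (18 * u) = (Real.exp 1 ^ 18) ^ u := by
      rw [← Real.exp_nat_mul, ← Real.exp_mul]; norm_num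
    rw [this]
    have h3 : Real.exp 1 ≤ 3 := by linarith [Real.exp_one_lt_d9]
    gcongr
  have hε14 : ε ^ (14 * u) = ε ^ (13 * u) * ε ^ u := by
    rw [← Real.rpow_add hε0]; congr 1; ring
  have hεu : ε ^ u ≤ 1 / 7 := by
    calc ε ^ u ≤ ε ^ (1 : ℝ) := Real.rpow_le_rpow_of_exponent_ge hε0 (by linarith) hu
      _ ≤ 1 / 7 := by rw [Real.rpow_one]; exact hε
  have h36 : 2 * ((3 : ℝ) ^ 18) ^ u ≤ ((6 : ℝ) ^ 13) ^ u := by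
    calc 2 * ((3 : ℝ) ^ 18) ^ u ≤ (2 : ℝ) ^ u * ((3 : ℝ) ^ 18) ^ u := by
          gcongr
          calc (2 : ℝ) = 2 ^ (1 : ℝ) := by rw [Real.rpow_one]
            _ ≤ 2 ^ u := Real.rpow_le_rpow_of_exponent_le (by norm_num) hu
      _ = (2 * (3 : ℝ) ^ 18) ^ u := by rw [Real.mul_rpow (by norm_num) (by norm_num)]
      _ ≤ _ := by
          apply Real.rpow_le_rpow (by norm_num) (by norm_num) (by linarith)
  have hS : (0 : ℝ) < ((6 : ℝ) ^ 13) ^ u := by positivity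
  rw [hmul] at hPC
  have hQ : P * C * ε ^ (13 * u) ≤ 1 / 2 := by
    have : 2 * (P * C * ε ^ (13 * u)) * ((6 : ℝ) ^ 13) ^ u ≤ 1 * ((6 : ℝ) ^ 13) ^ u := by
      nlinarith
    have := le_of_mul_le_mul_right this hS
    linarith
  rw [hε14]
  calc 14 * (P * C) * (ε ^ (13 * u) * ε ^ u)
      = 14 * ((P * C * ε ^ (13 * u)) * ε ^ u) := by ring
    _ ≤ 14 * ((1 / 2) * (1 / 7)) := by gcongr
    _ = 1 := by norm_num

/-- Lemma 2.2: a sparse coloring contains a large monochromatic pair. -/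
theorem exists_mono_pair_of_sparse (ε : ℝ) (hε0 : 0 < ε) (hε : ε ≤ 1 / 7)
    (t N : ℕ) (ht0 : 0 < t) (hN0 : 0 < N)
    (ht : ε⁻¹ ≤ (t : ℝ))
    (hN : (t : ℝ) * ε ^ (-(14 * ε * t)) ≤ (N : ℝ))
    (blue : SimpleGraph (Fin N))
    (hdens : (blue.edgeSet.ncard : ℝ) / (N.choose 2 : ℝ) ≤ ε) :
    ∃ X Y : Finset (Fin N), IsMonoPair blue X Y ∧
      (t : ℝ) ≤ (X.card : ℝ) ∧ ε ^ (14 * ε * t) * N ≤ (Y.card : ℝ) := by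
  classical
  have hu : 1 ≤ ε * t := by
    have := mul_le_mul_of_nonneg_left ht hε0.le
    rwa [mul_inv_cancel₀ hε0.ne'] at this
  obtain ⟨u, hudef⟩ : ∃ u, u = ε * (t : ℝ) := ⟨_, rfl⟩
  have hassoc : 14 * ε * t = 14 * u := by rw [hudef]; ring
  rw [hassoc] at hN ⊢
  rw [← hudef] at hu
  have hNpos : (0 : ℝ) < N := by exact_mod_cast hN0
  have htpos : (1 : ℝ) ≤ t := by exact_mod_cast ht0
  obtain ⟨q, hq⟩ : ∃ q, q = ε ^ (14 * u) := ⟨_, rfl⟩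
  have hq0 : 0 < q := by rw [hq]; positivity
  have hqN : (t : ℝ) ≤ q * N := by
    rw [Real.rpow_neg hε0.le, ← hq, ← div_eq_mul_inv, div_le_iff₀ hq0] at hN
    linarith
  have hqs : q ≤ 1 / 49 := by
    rw [hq]
    calc ε ^ (14 * u) ≤ ε ^ (2 : ℝ) :=
          Real.rpow_le_rpow_of_exponent_ge hε0 (by linarith) (by linarith)
      _ = ε ^ 2 := by norm_cast
      _ ≤ (1 / 7) ^ 2 := by gcongr
      _ = 1 / 49 := by norm_num
  rw [← hq]
  have htN : (t : ℝ) ≤ N / 49 := by nlinarith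
  -- degrees
  have hedge : 2 * (blue.edgeFinset.card : ℝ) ≤ ε * N ^ 2 := by
    have e1 : blue.edgeSet.ncard = blue.edgeFinset.card := by
      rw [← SimpleGraph.coe_edgeFinset, Set.ncard_coe_finset]
    rw [e1] at hdens
    have hN2 : 2 ≤ N := by
      have : (2 : ℝ) ≤ N := by linarith
      exact_mod_cast this
    have hc : (0 : ℝ) < N.choose 2 := by exact_mod_cast Nat.choose_pos hN2
    rw [div_le_iff₀ hc, Nat.cast_choose_two] at hdens
    nlinarith
  have hsum : (∑ v, (blue.degree v : ℝ)) ≤ ε * N ^ 2 := by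
    have := blue.sum_degrees_eq_twice_card_edges
    have h2 : (∑ v, (blue.degree v : ℝ)) = 2 * (blue.edgeFinset.card : ℝ) := by
      exact_mod_cast this
    rw [h2]; exact hedge
  set L : Finset (Fin N) := Finset.univ.filter (fun v => (blue.degree v : ℝ) ≤ 2 * ε * N) with hL
  have hLcard : (N : ℝ) / 2 ≤ L.card := by
    have hs := Finset.card_filter_add_card_filter_not (s := (Finset.univ : Finset (Fin N)))
      (fun v => (blue.degree v : ℝ) ≤ 2 * ε * N)
    rw [Finset.card_univ, Fintype.card_fin] at hs
    have hs' : (L.card : ℝ) + ((Finset.univ.filter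
      (fun v => ¬ (blue.degree v : ℝ) ≤ 2 * ε * N)).card : ℝ) = N := by exact_mod_cast hs
    have hb : ((Finset.univ.filter
      (fun v => ¬ (blue.degree v : ℝ) ≤ 2 * ε * N)).card : ℝ) * (2 * ε * N) ≤ ε * N ^ 2 := by
      rw [← nsmul_eq_mul]
      refine le_trans (Finset.card_nsmul_le_sum _ (fun v => (blue.degree v : ℝ)) _ ?_) (le_trans
        (Finset.sum_le_sum_of_subset_of_nonneg (Finset.filter_subset _ _)
          (fun _ _ _ => by positivity)) hsum)
      intro v hv
      exact (not_le.1 (Finset.mem_filter.1 hv).2).le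
    have hpos : 0 < ε * N := by positivity
    have : ((Finset.univ.filter
      (fun v => ¬ (blue.degree v : ℝ) ≤ 2 * ε * N)).card : ℝ) * 2 ≤ N := by
      apply le_of_mul_le_mul_right _ hpos
      nlinarith
    linarith
  -- maximal red clique in L of size at most t
  obtain ⟨I, hI, hImax⟩ := Finset.exists_max_image
    (L.powerset.filter (fun I => I.card ≤ t ∧ ∀ x ∈ I, ∀ z ∈ I, x ≠ z → ¬ blue.Adj x z))
    Finset.card ⟨∅, by simp⟩
  rw [Finset.mem_filter, Finset.mem_powerset] at hI
  obtain ⟨hIL, hIt, hIred⟩ := hI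
  have hItR : (I.card : ℝ) ≤ t := by exact_mod_cast hIt
  -- good vertices
  set nb : Fin N → Finset (Fin N) := fun v => I.filter (fun x => blue.Adj x v) with hnb
  have hnbsum : (∑ v, ((nb v).card : ℝ)) ≤ t * (2 * ε * N) := by
    have h1 : ∑ v, (nb v).card = ∑ x ∈ I, blue.degree x := by
      have := Finset.sum_card_bipartiteAbove_eq_sum_card_bipartiteBelow
        (s := I) (t := (Finset.univ : Finset (Fin N))) (fun x v => blue.Adj x v)
      simp only [Finset.bipartiteAbove, Finset.bipartiteBelow] at this
      rw [hnb, ← this]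
      apply Finset.sum_congr rfl
      intro x _
      rw [← SimpleGraph.card_neighborFinset_eq_degree, SimpleGraph.neighborFinset_eq_filter]
    have h1' : (∑ v, ((nb v).card : ℝ)) = ∑ x ∈ I, (blue.degree x : ℝ) := by exact_mod_cast h1
    rw [h1']
    calc ∑ x ∈ I, (blue.degree x : ℝ) ≤ I.card • (2 * ε * N) := by
          apply Finset.sum_le_card_nsmul
          intro x hx
          exact (Finset.mem_filter.1 (hIL hx)).2
      _ ≤ _ := by rw [nsmul_eq_mul]; gcongr
  set B : Finset (Fin N) := Finset.univ.filter (fun v => ¬ ((nb v).card : ℝ) ≤ 6 * u) with hB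
  have hBcard : (B.card : ℝ) ≤ N / 3 := by
    have hb : (B.card : ℝ) * (6 * u) ≤ t * (2 * ε * N) := by
      rw [← nsmul_eq_mul]
      refine le_trans (Finset.card_nsmul_le_sum _ (fun v => ((nb v).card : ℝ)) _ ?_) (le_trans
        (Finset.sum_le_sum_of_subset_of_nonneg (Finset.filter_subset _ _)
          (fun _ _ _ => by positivity)) hnbsum)
      intro v hv
      exact (not_le.1 (Finset.mem_filter.1 hv).2).le
    have hpos : 0 < u := by linarith
    apply le_of_mul_le_mul_right _ hpos
    have : (t : ℝ) * (2 * ε * N) = 2 * u * N := by rw [hudef]; ring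
    nlinarith
  set G : Finset (Fin N) := L \ (I ∪ B) with hG
  have hGcard : (N : ℝ) / 7 ≤ G.card := by
    have h1 : L.card ≤ G.card + (I.card + B.card) := by
      have h2 := Finset.le_card_sdiff (I ∪ B) L
      have h3 := Finset.card_union_le I B
      rw [← hG] at h2
      omega
    have h1' : (L.card : ℝ) ≤ G.card + (I.card + B.card) := by exact_mod_cast h1
    linarith
  set P := I.powerset.filter (fun S => (S.card : ℝ) ≤ 6 * u) with hP
  have hl0 : 0 < 6 * ε := by positivity
  have hl1 : 6 * ε ≤ 1 := by linarith
  have hPb := small_subsets_bound I (6 * ε) (6 * u) hl0 hl1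
  rw [← hP] at hPb
  have hPne : P.Nonempty := ⟨∅, by rw [hP]; simp; linarith⟩
  have hPpos : (0 : ℝ) < P.card := by exact_mod_cast hPne.card_pos
  have hmaps : ∀ v ∈ G, nb v ∈ P := by
    intro v hv
    rw [hP, Finset.mem_filter, Finset.mem_powerset]
    refine ⟨Finset.filter_subset _ _, ?_⟩
    by_contra hcon
    have hvB : v ∈ B := by rw [hB, Finset.mem_filter]; exact ⟨Finset.mem_univ _, hcon⟩
    rw [hG, Finset.mem_sdiff, Finset.mem_union] at hv
    exact hv.2 (Or.inr hvB)
  obtain ⟨S, hSP, hSc⟩ := Finset.exists_le_card_fiber_of_nsmul_le_card_of_maps_to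
    (b := (G.card : ℝ) / P.card) hmaps hPne
    (by rw [nsmul_eq_mul, mul_div_cancel₀ _ hPpos.ne'])
  set W := G.filter (fun v => nb v = S) with hW
  rw [hP, Finset.mem_filter, Finset.mem_powerset] at hSP
  obtain ⟨hSI, hS6⟩ := hSP
  set y : ℕ := ⌈q * N⌉₊ with hy
  have hy1 : q * N ≤ y := Nat.le_ceil _
  have hy2 : (y : ℝ) ≤ 2 * (q * N) := by
    have := Nat.ceil_lt_add_one (a := q * N) (by positivity)
    linarith
  have hy0 : 0 < y := Nat.ceil_pos.2 (by positivity)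
  have hWy : y * ((S.card + 1) + t).choose (S.card + 1) ≤ W.card := by
    have ha : ((S.card + 1 : ℕ) : ℝ) ≤ 7 * u := by push_cast; linarith
    have hCb := choose_bound ((S.card + 1) + t) (S.card + 1) (6 * ε) (7 * u) hl0 hl1 ha
    have hle : (S.card + 1) + t ≤ t * 2 := by
      have : ((S.card + 1 : ℕ) : ℝ) ≤ t := by
        have : 7 * u ≤ t := by rw [hudef]; nlinarith
        linarith
      have : S.card + 1 ≤ t := by exact_mod_cast this
      omega
    have h1l : 1 ≤ 1 + 6 * ε := by linarith
    have hCb' := hCb.trans (pow_le_pow_right₀ h1l hle)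
    rw [pow_mul] at hCb'
    have hA : (1 + 6 * ε) ^ t ≤ Real.exp (6 * u) := by
      have e : Real.exp (6 * u) = Real.exp (6 * ε) ^ t := by
        rw [← Real.exp_nat_mul, hudef]; congr 1; ring
      rw [e]
      have := Real.add_one_le_exp (6 * ε)
      gcongr
      linarith
    have hnum := numeric_bound ε hε0 hε u P.card
      (((S.card + 1) + t).choose (S.card + 1) : ℕ) ((1 + 6 * ε) ^ t) hu (by positivity)
      (by positivity) (by positivity) hA (hPb.trans (pow_le_pow_right₀ h1l hIt)) hCb'
    rw [← hq] at hnum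
    have hR : ((y * ((S.card + 1) + t).choose (S.card + 1) : ℕ) : ℝ) ≤ W.card := by
      refine le_trans ?_ hSc
      rw [le_div_iff₀ hPpos]
      refine le_trans ?_ hGcard
      push_cast
      set C : ℝ := ((((S.card + 1) + t).choose (S.card + 1) : ℕ) : ℝ) with hC
      have hC0 : 0 ≤ C := by positivity
      calc (y : ℝ) * C * P.card ≤ 2 * (q * N) * C * P.card := by gcongr
        _ = (14 * (P.card * C) * q) * (N / 7) := by ring
        _ ≤ 1 * (N / 7) := by gcongr
        _ = N / 7 := one_mul _
    exact_mod_cast hR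
  obtain ⟨X, Y, hXW, hYW, hYc, hpair⟩ := ramsey_pair blue y hy0 _ (S.card + 1) t rfl W hWy
  have hYR : q * N ≤ (Y.card : ℝ) := hy1.trans (by exact_mod_cast hYc)
  rcases hpair with ⟨⟨hd, hred⟩, hXc⟩ | ⟨hblue, hXc⟩
  · have hWI : ∀ w ∈ W, w ∈ L ∧ w ∉ I ∧ ∀ x ∈ I \ S, ¬ blue.Adj x w := by
      intro w hw
      rw [hW, Finset.mem_filter, hG, Finset.mem_sdiff, Finset.mem_union] at hw
      obtain ⟨⟨hwL, hwI⟩, hwS⟩ := hw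
      refine ⟨hwL, fun h => hwI (Or.inl h), ?_⟩
      intro x hx hadj
      rw [Finset.mem_sdiff] at hx
      apply hx.2
      rw [← hwS, hnb]
      exact Finset.mem_filter.2 ⟨hx.1, hadj⟩
    have hdisj : Disjoint (I \ S) X := by
      rw [Finset.disjoint_left]
      intro x hx hx'
      exact (hWI x (hXW hx')).2.1 (Finset.mem_sdiff.1 hx).1
    have hJpair : IsRedPair blue (I \ S ∪ X) Y := by
      refine ⟨?_, ?_⟩
      · rw [Finset.disjoint_union_left]
        refine ⟨?_, hd⟩
        rw [Finset.disjoint_left]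
        intro x hx hx'
        exact (hWI x (hYW hx')).2.1 (Finset.mem_sdiff.1 hx).1
      · intro x hx z hz hxz
        rw [Finset.union_assoc] at hz
        rcases Finset.mem_union.1 hx with hx | hx
        · rcases Finset.mem_union.1 hz with hz | hz
          · exact hIred x (Finset.mem_sdiff.1 hx).1 z (Finset.mem_sdiff.1 hz).1 hxz
          · exact (hWI z (Finset.union_subset hXW hYW hz)).2.2 x hx
        · rcases Finset.mem_union.1 hz with hz | hz
          · intro h; exact (hWI x (hXW hx)).2.2 z hz h.symm
          · exact hred x hx z hz hxz
    have hJc : (I \ S ∪ X).card = I.card + 1 := by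
      rw [Finset.card_union_of_disjoint hdisj, hXc, Finset.card_sdiff_of_subset hSI]
      have := Finset.card_le_card hSI
      omega
    have hIeq : t ≤ I.card := by
      by_contra hcon
      have := hImax (I \ S ∪ X) (by
        rw [Finset.mem_filter, Finset.mem_powerset]
        refine ⟨Finset.union_subset (fun x hx => hIL (Finset.mem_sdiff.1 hx).1)
          (fun x hx => (hWI x (hXW hx)).1), by omega, ?_⟩
        intro x hx z hz hxz
        exact hJpair.2 x hx z (Finset.mem_union_left _ hz) hxz)
      omega
    refine ⟨I \ S ∪ X, Y, Or.inr hJpair, ?_, hYR⟩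
    exact_mod_cast (by omega : t ≤ (I \ S ∪ X).card)
  · exact ⟨X, Y, Or.inl hblue, by rw [hXc], hYR⟩
end

section
/- Let $G$ be a graph with $n$ vertices and maximum degree $\Delta$, and let $0 < \epsilon \leq 1/8$. If $H$ is a graph with $N \geq \epsilon^{4\Delta \log \epsilon}\, n$ vertices that does not contain a copy of $G$ as a subgraph, then $H$ has a vertex subset $S$ with $|S| \geq \epsilon^{-4\Delta \log \epsilon} N$ such that the edge density of the induced subgraph $H[S]$ is at most $\epsilon$. -/
/-- Greedy embedding: if no sparse pair exists in `U`, we can embed all of `T`. -/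
lemma greedy_embed {α β : Type*} [Fintype α] [DecidableEq α] [DecidableEq β]
    (G : SimpleGraph α) (H : SimpleGraph β) [DecidableRel G.Adj] [DecidableRel H.Adj]
    (Δ : ℕ) (hΔ : ∀ v : α, (Finset.univ.filter (G.Adj v)).card ≤ Δ)
    (c m : ℝ) (hc0 : 0 < c) (hc : c ≤ 1 / 8) (hm : (Fintype.card α : ℝ) ≤ m)
    (U : Finset β) (hU : (2 / c) ^ Δ * m ≤ U.card)
    (hno : ∀ A B : Finset β, A ⊆ U → B ⊆ U → m ≤ A.card → 8 * m ≤ B.card →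
      ∃ a ∈ A, c * B.card ≤ ((B.filter (H.Adj a)).card : ℝ)) (T : Finset α) :
    ∃ f : α → β, Set.InjOn f T ∧ (∀ a ∈ T, ∀ b ∈ T, G.Adj a b → H.Adj (f a) (f b)) ∧
      ∀ v, v ∉ T → c ^ (T.filter (G.Adj v)).card * (U.card : ℝ) ≤
        ((U.filter (fun x => ∀ w ∈ T, G.Adj v w → H.Adj (f w) x)).card : ℝ) := by
  have hm0 : 0 ≤ m := le_trans (by positivity) hm
  have hUm : (2 : ℝ) ^ Δ * m ≤ c ^ Δ * U.card := by
    have h1 := mul_le_mul_of_nonneg_left hU (pow_nonneg hc0.le Δ)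
    rw [← mul_assoc, ← mul_pow, mul_div_cancel₀ _ hc0.ne'] at h1
    exact h1
  induction T using Finset.induction_on with
  | empty =>
    by_cases hne : Nonempty β
    · obtain ⟨b⟩ := hne
      exact ⟨fun _ => b, by simp, by simp, by simp⟩
    · by_cases hα : IsEmpty α
      · exact ⟨fun a => (hα.false a).elim, by simp, by simp, by simp⟩
      · exfalso
        rw [not_isEmpty_iff] at hα
        rw [not_nonempty_iff] at hne
        have h1 : U.card = 0 := by
          rw [Finset.card_eq_zero]; exact Subsingleton.elim _ _
        rw [h1] at hU
        have h2 : (0 : ℝ) < Fintype.card α := by exact_mod_cast Fintype.card_pos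
        have h3 : 0 < (2 / c) ^ Δ * m := mul_pos (by positivity) (by linarith)
        simp at hU; linarith
  | insert v T hv ih =>
    obtain ⟨f, hinj, hadj, hcand⟩ := ih
    set V : α → Finset β := fun u => U.filter (fun x => ∀ w ∈ T, G.Adj u w → H.Adj (f w) x) with hV
    set W := V v \ T.image f with hW
    set Nb := Finset.univ.filter (fun u => G.Adj v u ∧ u ∉ T) with hNb
    set Bad : α → Finset β := fun u =>
      W.filter (fun x => (((V u).filter (H.Adj x)).card : ℝ) < c * (V u).card) with hBad
    have hc1 : c ≤ 1 := by linarith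
    have hBadc : ∀ u ∈ Nb, ((Bad u).card : ℝ) ≤ m := by
      intro u hu
      simp only [hNb, Finset.mem_filter, Finset.mem_univ, true_and] at hu
      by_contra hcon
      push Not at hcon
      obtain ⟨a, ha, hb⟩ := hno (Bad u) (V u)
        (by intro x hx; simp only [hBad, hW, hV, Finset.mem_filter, Finset.mem_sdiff] at hx; exact hx.1.1.1)
        (Finset.filter_subset _ _) hcon.le
        (by
          have h1 : (T.filter (G.Adj u)).card + 1 ≤ Δ := by
            refine le_trans ?_ (hΔ u)
            rw [← Finset.card_insert_of_notMem (a := v) (by simp [hv])]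
            apply Finset.card_le_card
            intro x hx
            simp only [Finset.mem_insert, Finset.mem_filter, Finset.mem_univ, true_and] at hx ⊢
            rcases hx with rfl | hx
            · exact hu.1.symm
            · exact hx.2
          have h2 := hcand u hu.2
          have h3 : c ^ Δ ≤ c ^ ((T.filter (G.Adj u)).card + 1) :=
            pow_le_pow_of_le_one hc0.le hc1 h1
          have h4 : c ^ Δ * (U.card : ℝ) ≤ c * (V u).card := by
            calc c ^ Δ * (U.card : ℝ) ≤ c ^ ((T.filter (G.Adj u)).card + 1) * (U.card : ℝ) := by gcongr
              _ = c * (c ^ ((T.filter (G.Adj u)).card) * (U.card : ℝ)) := by ring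
              _ ≤ _ := by gcongr
          have h5 : (1 : ℝ) ≤ 2 ^ Δ := one_le_pow₀ (by norm_num)
          have h6 : m ≤ 2 ^ Δ * m := by nlinarith
          have h7 : c * ((V u).card : ℝ) ≤ 1 / 8 * (V u).card := by gcongr
          linarith)
      simp only [hBad, Finset.mem_filter] at ha
      linarith [ha.2]
    have hNbc : Nb.card ≤ Δ := by
      refine le_trans (Finset.card_le_card ?_) (hΔ v)
      intro x hx
      simp only [hNb, Finset.mem_filter] at hx ⊢
      exact ⟨hx.1, hx.2.1⟩
    have hBU : ((Nb.biUnion Bad).card : ℝ) ≤ Δ * m := by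
      calc ((Nb.biUnion Bad).card : ℝ) ≤ ∑ u ∈ Nb, ((Bad u).card : ℝ) := by
            exact_mod_cast Finset.card_biUnion_le
        _ ≤ ∑ u ∈ Nb, m := Finset.sum_le_sum hBadc
        _ = Nb.card * m := by simp
        _ ≤ Δ * m := by gcongr
    have hTn : ((T.image f).card : ℝ) < m := by
      have h1 : T.card < Fintype.card α := by
        rw [← Finset.card_univ]
        apply Finset.card_lt_card
        rw [Finset.ssubset_univ_iff]
        rintro rfl
        simp at hv
      have h2 : (T.image f).card < Fintype.card α := lt_of_le_of_lt Finset.card_image_le h1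
      have h3 : ((T.image f).card : ℝ) < Fintype.card α := by exact_mod_cast h2
      linarith
    have hVv : ((Δ : ℝ) + 1) * m ≤ (V v).card := by
      have h1 : (T.filter (G.Adj v)).card ≤ Δ := by
        refine le_trans (Finset.card_le_card ?_) (hΔ v)
        exact Finset.filter_subset_filter _ (Finset.subset_univ _)
      have h2 := hcand v hv
      have h3 : c ^ Δ ≤ c ^ (T.filter (G.Adj v)).card := pow_le_pow_of_le_one hc0.le hc1 h1
      have h4 : c ^ Δ * (U.card : ℝ) ≤ c ^ (T.filter (G.Adj v)).card * (U.card : ℝ) := by gcongr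
      have h5 : (Δ : ℝ) + 1 ≤ 2 ^ Δ := by exact_mod_cast Nat.lt_two_pow_self
      have h6 : ((Δ : ℝ) + 1) * m ≤ 2 ^ Δ * m := by gcongr
      linarith
    have hWc : ((V v).card : ℝ) ≤ W.card + (T.image f).card := by
      have := Finset.le_card_sdiff (T.image f) (V v)
      rw [← hW] at this
      have h2 : (V v).card ≤ W.card + (T.image f).card := by omega
      exact_mod_cast h2
    have hlt : (Nb.biUnion Bad).card < W.card := by
      have : ((Nb.biUnion Bad).card : ℝ) < W.card := by linarith
      exact_mod_cast this
    obtain ⟨x, hxW, hxB⟩ := Finset.exists_mem_notMem_of_card_lt_card hlt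
    have hxV : x ∈ V v := (Finset.mem_sdiff.1 hxW).1
    have hxT : ∀ w ∈ T, f w ≠ x := by
      intro w hw he
      exact (Finset.mem_sdiff.1 hxW).2 (Finset.mem_image.2 ⟨w, hw, he⟩)
    have hxA : ∀ w ∈ T, G.Adj v w → H.Adj (f w) x := (Finset.mem_filter.1 hxV).2
    have hne : ∀ w ∈ T, w ≠ v := fun w hw h => hv (h ▸ hw)
    have hfw : ∀ w ∈ T, Function.update f v x w = f w :=
      fun w hw => Function.update_of_ne (hne w hw) _ _
    refine ⟨Function.update f v x, ?_, ?_, ?_⟩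
    · intro a ha b hb hab
      simp only [Finset.coe_insert, Set.mem_insert_iff, Finset.mem_coe] at ha hb
      rcases ha with rfl | ha <;> rcases hb with rfl | hb
      · rfl
      · rw [hfw b hb, Function.update_self] at hab
        exact absurd hab.symm (hxT b hb)
      · rw [hfw a ha, Function.update_self] at hab
        exact absurd hab (hxT a ha)
      · rw [hfw a ha, hfw b hb] at hab
        exact hinj ha hb hab
    · intro a ha b hb hab
      simp only [Finset.mem_insert] at ha hb
      rcases ha with rfl | ha <;> rcases hb with rfl | hb
      · exact absurd hab (G.irrefl)
      · rw [hfw b hb, Function.update_self]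
        exact (hxA b hb hab).symm
      · rw [hfw a ha, Function.update_self]
        exact hxA a ha hab.symm
      · rw [hfw a ha, hfw b hb]
        exact hadj a ha b hb hab
    · intro u hu
      simp only [Finset.mem_insert, not_or] at hu
      have h2 := hcand u hu.2
      by_cases huv : G.Adj u v
      · have hset : U.filter (fun y => ∀ w ∈ insert v T, G.Adj u w → H.Adj (Function.update f v x w) y)
            = (V u).filter (H.Adj x) := by
          ext y
          simp only [hV, Finset.mem_filter, Finset.mem_insert, forall_eq_or_imp, Function.update_self,
            and_assoc]
          refine and_congr_right fun _ => ?_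
          constructor
          · rintro ⟨h1, h3⟩
            exact ⟨fun w hw hh => by rw [← hfw w hw]; exact h3 w hw hh, h1 huv⟩
          · rintro ⟨h1, h3⟩
            exact ⟨fun _ => h3, fun w hw hh => by rw [hfw w hw]; exact h1 w hw hh⟩
        rw [hset, Finset.filter_insert, if_pos huv, Finset.card_insert_of_notMem (by simp [hv])]
        have huN : u ∈ Nb := by simp [hNb, huv.symm, hu.2]
        have hxb : x ∉ Bad u := fun h => hxB (Finset.mem_biUnion.2 ⟨u, huN, h⟩)
        have h3 : c * ((V u).card : ℝ) ≤ (((V u).filter (H.Adj x)).card : ℝ) := by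
          by_contra hcon
          push Not at hcon
          exact hxb (Finset.mem_filter.2 ⟨hxW, hcon⟩)
        calc _ = c * (c ^ ((T.filter (G.Adj u)).card) * (U.card : ℝ)) := by ring
          _ ≤ c * (V u).card := by gcongr
          _ ≤ _ := h3
      · have hset : U.filter (fun y => ∀ w ∈ insert v T, G.Adj u w → H.Adj (Function.update f v x w) y)
            = V u := by
          ext y
          simp only [hV, Finset.mem_filter, Finset.mem_insert, forall_eq_or_imp, Function.update_self]
          refine and_congr_right fun _ => ?_
          constructor
          · rintro ⟨h1, h3⟩
            exact fun w hw hh => by rw [← hfw w hw]; exact h3 w hw hh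
          · intro h1
            exact ⟨fun h => absurd h huv, fun w hw hh => by rw [hfw w hw]; exact h1 w hw hh⟩
        rw [hset, Finset.filter_insert, if_neg huv]
        exact h2

/-- A graph without a copy of `G` has a one-sided sparse pair in each large set. -/
lemma sparse_pair_s10 {α β : Type*} [Fintype α] [DecidableEq α] [DecidableEq β]
    (G : SimpleGraph α) (H : SimpleGraph β) [DecidableRel G.Adj] [DecidableRel H.Adj]
    (Δ : ℕ) (hΔ : ∀ v : α, (Finset.univ.filter (G.Adj v)).card ≤ Δ)
    (c m : ℝ) (hc0 : 0 < c) (hc : c ≤ 1 / 8) (hm : (Fintype.card α : ℝ) ≤ m)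
    (hG : ¬ IsCopyIn G H)
    (U : Finset β) (hU : (2 / c) ^ Δ * m ≤ U.card) :
    ∃ A B : Finset β, A ⊆ U ∧ B ⊆ U ∧ m ≤ A.card ∧ 8 * m ≤ B.card ∧
      ∀ a ∈ A, ((B.filter (H.Adj a)).card : ℝ) ≤ c * B.card := by
  by_contra hcon
  push Not at hcon
  obtain ⟨f, hinj, hadj, -⟩ := greedy_embed G H Δ hΔ c m hc0 hc hm U hU
    (fun A B hA hB h1 h2 => by
      obtain ⟨a, ha, h⟩ := hcon A B hA hB h1 h2
      exact ⟨a, ha, h.le⟩) Finset.univ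
  refine hG ⟨⟨f, fun a b h => hinj (by simp) (by simp) h⟩, fun a b h => hadj a (by simp) b (by simp) h⟩

/-- Iterating the sparse pair lemma. -/
lemma iterate_sparse {β : Type*} [DecidableEq β]
    (H : SimpleGraph β) [DecidableRel H.Adj] (c m F : ℝ) (hc0 : 0 < c) (hm : 1 ≤ m) (hF : 2 ≤ F)
    (hpair : ∀ r : ℝ, m ≤ r → ∀ U : Finset β, F * r ≤ U.card →
      ∃ A B : Finset β, A ⊆ U ∧ B ⊆ U ∧ r ≤ A.card ∧ 8 * r ≤ B.card ∧
      ∀ a ∈ A, ((B.filter (H.Adj a)).card : ℝ) ≤ c * B.card)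
    (s : ℕ) (hs : s = ⌈m⌉₊) (k : ℕ) :
    ∀ U : Finset β, F ^ k * m ≤ U.card → ∃ S ⊆ U, S.card = 2 ^ k * s ∧
      ((∑ x ∈ S, (S.filter (H.Adj x)).card : ℕ) : ℝ) ≤
        2 ^ k * s * (s - 1) + 2 * c * 2 ^ k * (2 ^ k - 1) * s ^ 2 := by
  have hs1 : (1 : ℝ) ≤ s := by
    rw [hs]; exact hm.trans (Nat.le_ceil m)
  have hs2 : (s : ℝ) ≤ 2 * m := by
    rw [hs]; linarith [Nat.ceil_lt_add_one (show 0 ≤ m by linarith)]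
  induction k with
  | zero =>
    intro U hU
    simp only [pow_zero, one_mul] at hU
    obtain ⟨S, hSU, hSc⟩ := Finset.exists_subset_card_eq (s := U) (n := s)
      (by rw [hs]; exact Nat.ceil_le.2 hU)
    refine ⟨S, hSU, by simp [hSc], ?_⟩
    have h1 : ∀ x ∈ S, (((S.filter (H.Adj x)).card : ℕ) : ℝ) ≤ (s : ℝ) - 1 := by
      intro x hx
      have h2 : (S.filter (H.Adj x)).card < S.card := by
        apply Finset.card_lt_card
        rw [Finset.filter_ssubset]
        exact ⟨x, hx, H.irrefl⟩
      rw [hSc] at h2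
      have h3 : (((S.filter (H.Adj x)).card + 1 : ℕ) : ℝ) ≤ s := by exact_mod_cast h2
      push_cast at h3
      linarith
    have h2 := Finset.sum_le_sum h1
    rw [Finset.sum_const, hSc, nsmul_eq_mul] at h2
    push_cast
    simpa using h2
  | succ k ih =>
    intro U hU
    have hFk : 1 ≤ F ^ k := one_le_pow₀ (by linarith)
    have hF2 : (2 : ℝ) ^ k ≤ F ^ k := by gcongr
    set r := F ^ k * m with hr
    have hrm : m ≤ r := by nlinarith
    obtain ⟨A, B, hA, hB, hAc, hBc, hAB⟩ := hpair r hrm U (by rw [hr, ← mul_assoc, ← pow_succ']; exact hU)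
    obtain ⟨S, hSA, hSc, hSd⟩ := ih A hAc
    have hScR : (S.card : ℝ) = 2 ^ k * s := by rw [hSc]; push_cast; rfl
    have hSpos : (0 : ℝ) < S.card := by rw [hScR]; positivity
    have hSr : (S.card : ℝ) ≤ 2 * r := by
      rw [hScR, hr]
      calc (2 : ℝ) ^ k * s ≤ F ^ k * (2 * m) := by gcongr
        _ = _ := by ring
    -- double counting
    have hdc : ∑ x ∈ S, ((B.filter (H.Adj x)).card : ℝ) = ∑ y ∈ B, ((S.filter (H.Adj y)).card : ℝ) := by
      simp only [Finset.card_filter]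
      push_cast
      rw [Finset.sum_comm]
      simp only [H.adj_comm]
    have he : ∑ y ∈ B, ((S.filter (H.Adj y)).card : ℝ) ≤ S.card * (c * B.card) := by
      rw [← hdc]
      calc _ ≤ ∑ x ∈ S, (c * B.card) := Finset.sum_le_sum (fun x hx => hAB x (hSA hx))
        _ = _ := by simp
    set X := B.filter (fun y => 2 * c * S.card < ((S.filter (H.Adj y)).card : ℝ)) with hX
    set C := (B \ X) \ S with hC
    have hXc : 2 * (X.card : ℝ) ≤ B.card := by
      have h1 : (X.card : ℝ) * (2 * c * S.card) ≤ ∑ y ∈ B, ((S.filter (H.Adj y)).card : ℝ) := by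
        calc (X.card : ℝ) * (2 * c * S.card) = ∑ y ∈ X, (2 * c * S.card : ℝ) := by simp
          _ ≤ ∑ y ∈ X, ((S.filter (H.Adj y)).card : ℝ) :=
            Finset.sum_le_sum (fun y hy => (Finset.mem_filter.1 hy).2.le)
          _ ≤ _ := Finset.sum_le_sum_of_subset_of_nonneg (Finset.filter_subset _ _)
            (fun _ _ _ => by positivity)
      have h2 : (c * S.card) * (2 * (X.card : ℝ)) ≤ (c * S.card) * B.card := by nlinarith
      exact le_of_mul_le_mul_left h2 (by positivity)
    have hCc : r ≤ C.card := by
      have h1 := Finset.le_card_sdiff X B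
      have h2 := Finset.le_card_sdiff S (B \ X)
      rw [← hC] at h2
      have h3 : B.card ≤ C.card + X.card + S.card := by omega
      have h4 : (B.card : ℝ) ≤ C.card + X.card + S.card := by exact_mod_cast h3
      linarith
    obtain ⟨S', hS'C, hS'c, hS'd⟩ := ih C hCc
    have hdisj : Disjoint S S' := by
      rw [Finset.disjoint_left]
      intro x hx hx'
      exact (Finset.mem_sdiff.1 (hS'C hx')).2 hx
    have hS'deg : ∀ y ∈ S', ((S.filter (H.Adj y)).card : ℝ) ≤ 2 * c * S.card := by
      intro y hy
      have h1 := (Finset.mem_sdiff.1 (hS'C hy)).1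
      rw [Finset.mem_sdiff] at h1
      by_contra hcon
      push Not at hcon
      exact h1.2 (Finset.mem_filter.2 ⟨h1.1, hcon⟩)
    refine ⟨S ∪ S', ?_, ?_, ?_⟩
    · apply Finset.union_subset (hSA.trans hA)
      refine hS'C.trans (Finset.sdiff_subset.trans (Finset.sdiff_subset.trans hB))
    · rw [Finset.card_union_of_disjoint hdisj, hSc, hS'c]; ring
    · have hcross : ∑ x ∈ S, ((S'.filter (H.Adj x)).card : ℝ) = ∑ y ∈ S', ((S.filter (H.Adj y)).card : ℝ) := by
        simp only [Finset.card_filter]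
        push_cast
        rw [Finset.sum_comm]
        simp only [H.adj_comm]
      have hcr : ∑ y ∈ S', ((S.filter (H.Adj y)).card : ℝ) ≤ 2 * c * (2 ^ k * s) ^ 2 := by
        calc _ ≤ ∑ y ∈ S', (2 * c * S.card : ℝ) := Finset.sum_le_sum hS'deg
          _ = S'.card * (2 * c * S.card) := by simp
          _ = _ := by rw [hScR, hS'c]; push_cast; ring
      have hdeg : ∀ x, (((S ∪ S').filter (H.Adj x)).card : ℝ) =
          (S.filter (H.Adj x)).card + (S'.filter (H.Adj x)).card := by
        intro x
        rw [Finset.filter_union, Finset.card_union_of_disjoint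
          (Finset.disjoint_filter_filter hdisj)]
        push_cast; rfl
      push_cast at hSd hS'd ⊢
      rw [Finset.sum_union hdisj]
      simp only [hdeg, Finset.sum_add_distrib]
      rw [hcross]
      rw [pow_succ]
      nlinarith

lemma edge_count {β : Type*} [Fintype β] [DecidableEq β]
    (H : SimpleGraph β) [DecidableRel H.Adj] (S : Finset β) :
    ∑ x ∈ S, (S.filter (H.Adj x)).card = 2 * (H.induce (S : Set β)).edgeSet.ncard := by
  classical
  rw [Set.ncard_eq_toFinset_card', ← SimpleGraph.edgeFinset,
    ← SimpleGraph.sum_degrees_eq_twice_card_edges]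
  rw [← Finset.sum_coe_sort S]
  apply Finset.sum_congr rfl
  intro x _
  rw [← SimpleGraph.card_neighborFinset_eq_degree]
  symm
  apply Finset.card_bij (fun (y : (S : Set β)) _ => (y : β))
  · intro a ha
    simp only [SimpleGraph.mem_neighborFinset, SimpleGraph.comap_adj] at ha
    simp only [Finset.mem_filter]
    exact ⟨a.2, ha⟩
  · intro a _ b _ h
    exact Subtype.ext h
  · intro b hb
    simp only [Finset.mem_filter] at hb
    exact ⟨⟨b, hb.1⟩, by simp only [SimpleGraph.mem_neighborFinset, SimpleGraph.comap_adj]; exact hb.2, rfl⟩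

/-- Lemma 2.3: a graph avoiding a copy of a bounded-degree graph has a large
sparse vertex subset. -/
theorem exists_sparse_subset {α β : Type*} [Fintype α] [Fintype β]
    (G : SimpleGraph α) (H : SimpleGraph β)
    (n Δ N : ℕ) (hn : n = Fintype.card α) (hN : N = Fintype.card β)
    (hΔ : ∀ v : α, (G.neighborSet v).ncard ≤ Δ)
    (ε : ℝ) (hε0 : 0 < ε) (hε : ε ≤ 1 / 8)
    (hbigN : ε ^ (4 * (Δ : ℝ) * Real.logb 2 ε) * n ≤ (N : ℝ))
    (hno : ¬ IsCopyIn G H) :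
    ∃ S : Set β, ε ^ (-(4 * (Δ : ℝ) * Real.logb 2 ε)) * N ≤ (S.ncard : ℝ) ∧
      ((H.induce S).edgeSet.ncard : ℝ) / (S.ncard.choose 2 : ℝ) ≤ ε := by
  classical
  have hΔ' : ∀ v : α, (Finset.univ.filter (G.Adj v)).card ≤ Δ := by
    intro v
    have h := hΔ v
    rw [Set.ncard_eq_toFinset_card'] at h
    refine le_trans (Finset.card_le_card ?_) h
    intro x hx
    simpa using hx
  have hn1 : 1 ≤ n := by
    by_contra hcon
    have h0 : Fintype.card α = 0 := by omega
    have : IsEmpty α := Fintype.card_eq_zero_iff.1 h0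
    exact hno ⟨⟨fun a => isEmptyElim a, fun a => isEmptyElim a⟩, fun a => isEmptyElim a⟩
  have hΔ1 : 1 ≤ Δ := by
    by_contra hcon
    have h0 : Δ = 0 := by omega
    subst h0
    simp only [Nat.cast_zero, mul_zero, zero_mul, Real.rpow_zero, one_mul, Nat.cast_le] at hbigN
    rw [hn, hN] at hbigN
    obtain ⟨f⟩ := Function.Embedding.nonempty_of_card_le hbigN
    refine hno ⟨f, fun a b hab => ?_⟩
    have h1 := hΔ' a
    simp only [Nat.le_zero, Finset.card_eq_zero] at h1
    have h2 : b ∈ Finset.univ.filter (G.Adj a) := by simp [hab]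
    rw [h1] at h2
    simp at h2
  -- L = log (1/ε)
  set L := -Real.logb 2 ε with hL
  have hεL : ε = (2 : ℝ) ^ (-L) := by
    rw [hL, neg_neg, Real.rpow_logb (by norm_num) (by norm_num) hε0]
  have hL3 : 3 ≤ L := by
    have h1 : Real.logb 2 ε ≤ Real.logb 2 ((2 : ℝ) ^ (-3 : ℝ)) := by
      apply Real.logb_le_logb_of_le (by norm_num) hε0
      refine hε.trans (le_of_eq ?_)
      rw [Real.rpow_neg (by norm_num)]; norm_num
    rw [Real.logb_rpow (by norm_num) (by norm_num)] at h1
    rw [hL]; linarith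
  have hlog : Real.logb 2 ε = -L := by rw [hL, neg_neg]
  set Q := (2 : ℝ) ^ (4 * Δ * L ^ 2) with hQ
  have hQpos : 0 < Q := by positivity
  have hp1 : ε ^ (4 * (Δ : ℝ) * Real.logb 2 ε) = Q := by
    rw [hlog, hεL, ← Real.rpow_mul (by norm_num), hQ]
    congr 1; ring
  have hp2 : ε ^ (-(4 * (Δ : ℝ) * Real.logb 2 ε)) = Q⁻¹ := by
    rw [Real.rpow_neg hε0.le, hp1]
  rw [hp1] at hbigN
  rw [hp2]
  set K := ⌈L⌉₊ + 1 with hK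
  have hKL : (K : ℝ) ≤ L + 2 := by
    rw [hK]; push_cast
    linarith [Nat.ceil_lt_add_one (show 0 ≤ L by linarith)]
  have hKq : 2 ≤ ε * 2 ^ K := by
    have h1 : (2 : ℝ) ^ L ≤ 2 ^ ⌈L⌉₊ := by
      rw [← Real.rpow_natCast]
      exact Real.rpow_le_rpow_of_exponent_le (by norm_num) (Nat.le_ceil L)
    have h2 : ε * 2 ^ L = 1 := by
      rw [hεL, ← Real.rpow_add (by norm_num)]; simp
    have h3 : ε * 2 ^ L ≤ ε * 2 ^ ⌈L⌉₊ := by gcongr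
    rw [hK, pow_succ]; linarith
  set c := ε / 4 with hc
  set F := (2 / c) ^ Δ with hF
  have hc0 : 0 < c := by positivity
  have h2c : 2 / c = (2 : ℝ) ^ (L + 3) := by
    rw [Real.rpow_add (by norm_num), hc, hεL, Real.rpow_neg (by norm_num)]
    field_simp
    norm_num
  have hF2 : 2 ≤ F := by
    have h1 : 2 ≤ 2 / c := by
      rw [le_div_iff₀ hc0]; linarith
    exact h1.trans (le_self_pow₀ (by linarith) (by omega))
  have hFK : F ^ K ≤ Q := by
    rw [hF, h2c, ← pow_mul, ← Real.rpow_natCast, ← Real.rpow_mul (by norm_num), hQ]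
    apply Real.rpow_le_rpow_of_exponent_le (by norm_num)
    push_cast
    have h1 : (L + 3) * (K : ℝ) ≤ 4 * L ^ 2 := by
      have : (L + 3) * (K : ℝ) ≤ (L + 3) * (L + 2) := by gcongr
      nlinarith
    nlinarith [mul_le_mul_of_nonneg_left h1 (Nat.cast_nonneg (α := ℝ) Δ)]
  have hFpos : 0 < F ^ K := by positivity
  set m := (N : ℝ) / F ^ K with hm
  have hnm : (n : ℝ) ≤ m := by
    rw [hm, le_div_iff₀ hFpos]
    calc (n : ℝ) * F ^ K ≤ n * Q := by gcongr
      _ = Q * n := by ring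
      _ ≤ N := hbigN
  have hm1 : 1 ≤ m := le_trans (by exact_mod_cast hn1) hnm
  obtain ⟨S, -, hSc, hSd⟩ := iterate_sparse H c m F hc0 hm1 hF2
    (fun r hr U hU => sparse_pair_s10 G H Δ hΔ' c r hc0 (by linarith)
      (by rw [← hn]; linarith) hno U hU) ⌈m⌉₊ rfl K Finset.univ
    (by rw [hm, Finset.card_univ, ← hN, mul_div_cancel₀ _ hFpos.ne'])
  set s := ⌈m⌉₊ with hs
  have hs1 : (1 : ℝ) ≤ s := hm1.trans (Nat.le_ceil m)
  have hq1 : (1 : ℝ) ≤ 2 ^ K := one_le_pow₀ (by norm_num)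
  refine ⟨(S : Set β), ?_, ?_⟩
  · rw [Set.ncard_coe_finset, hSc]
    push_cast
    calc Q⁻¹ * (N : ℝ) ≤ (F ^ K)⁻¹ * N := by gcongr
      _ = m := by rw [hm]; ring
      _ ≤ s := Nat.le_ceil m
      _ ≤ 2 ^ K * s := by nlinarith
  · rw [edge_count] at hSd
    push_cast at hSd
    rw [Set.ncard_coe_finset, Nat.cast_choose_two, hSc]
    push_cast
    apply div_le_of_le_mul₀
    · have : 1 ≤ (2 : ℝ) ^ K * s := by nlinarith
      have h2 : 0 ≤ (2 : ℝ) ^ K * s - 1 := by linarith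
      positivity
    · exact hε0.le
    · generalize (2 : ℝ) ^ K = q at *
      generalize (s : ℝ) = t at *
      have key : (t - 1) + (ε / 2) * (q - 1) * t ≤ ε * (q * t - 1) := by
        have h1 : 2 * (t - 1) ≤ ε * q * (t - 1) := by
          apply mul_le_mul_of_nonneg_right hKq; linarith
        have h2 : ε * 2 ≤ ε * (q + t) := by gcongr; linarith
        nlinarith
      have h3 := mul_le_mul_of_nonneg_left key (show 0 ≤ q * t by positivity)
      have hc' : c = ε / 4 := hc
      rw [hc'] at hSd
      nlinarith
end
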